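/- Let k, m ∈ ℕ and let α ∈ (k−1, k) be a non-integer real with α > 0 and α + m > 1/2. There exists a constant C > 0, depending only on α and m, such that for every interval I = (a, x₁) with length h = x₁ − a satisfying 0 < h ≤ 2, every integer p with α + m < p + 1, and every ω̃ ∈ 𝒰^{α,m}_{x₁−}(I), the Gauss–Radau projections on I satisfy: ‖π_p^− ω̃ − ω̃‖_{L²(I)} ≤ C h^{α+1/2} p^{−min{2α+1/2, α+m−1/2}} U^{α,m}_{x₁−}(ω̃;I); ‖π_p^+ ω̃ − ω̃‖_{L²(I)} ≤ C h^{α+1/2} p^{−min{2α+1, α+m−1/2}} U^{α,m}_{x₁−}(ω̃;I); |(π_p^+ ω̃ − ω̃)(x₁)| ≤ C h^{α} p^{−min{2α, α+m−1/2}} U^{α,m}_{x₁−}(ω̃;I); and |(π_p^− ω̃ − ω̃)(a)| ≤ C h^{α} p^{−min{2α, α+m−1/2}} U^{α,m}_{x₁−}(ω̃;I). -/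

import Mathlib

open MeasureTheory Set Filter

/-- The right Caputo fractional derivative of order `α ∈ (k−1,k)` based at `b`. -/
noncomputable def caputoR (k : ℕ) (α b : ℝ) (u : ℝ → ℝ) (x : ℝ) : ℝ :=
  ((-1 : ℝ) ^ k / Real.Gamma ((k : ℝ) - α)) *
    ∫ y in x..b, (y - x) ^ ((k : ℝ) - α - 1) * iteratedDeriv k u y

/-- Membership `u ∈ 𝒰^{α,m}_{b−}((a,b))`, with `L i` the left-hand limits
`D^i(^C D^α_{b−} u)(b−)` for `i < m`. -/
def MemUROn (k m : ℕ) (α a b : ℝ) (u : ℝ → ℝ) (L : ℕ → ℝ) : Prop :=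
  ContinuousOn u (Icc a b) ∧
  (∀ i < k, ∀ x ∈ Ioo a b,
      HasDerivAt (iteratedDeriv i u) (iteratedDeriv (i + 1) u x) x) ∧
  (∀ i ≤ k, IntervalIntegrable (iteratedDeriv i u) volume a b) ∧
  (∀ i < m, ∀ x ∈ Ioo a b,
      HasDerivAt (iteratedDeriv i (caputoR k α b u))
        (iteratedDeriv (i + 1) (caputoR k α b u) x) x) ∧
  (∀ i ≤ m, IntervalIntegrable (iteratedDeriv i (caputoR k α b u)) volume a b) ∧
  (∀ i < m, Tendsto (iteratedDeriv i (caputoR k α b u))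
      (nhdsWithin b (Iio b)) (nhds (L i)))

/-- The semi-norm `U^{α,m}_{b−}(u;(a,b))`. -/
noncomputable def UsemiROn (k m : ℕ) (α a b : ℝ) (u : ℝ → ℝ) (L : ℕ → ℝ) : ℝ :=
  (∫ x in a..b, |iteratedDeriv m (caputoR k α b u) x|) +
    ∑ i ∈ Finset.range m, |L i|

open Polynomial in
/-- The polynomials `Q` for which `(1 + y) ^ s * Q n / s` is the left fractional integral
`∫ x in -1..y, (y - x) ^ (s - 1) * Pₙ x` of the Legendre polynomial `Pₙ`; for `s = 0` these are
the Legendre polynomials themselves. -/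
noncomputable def fracLegendre (s : ℝ) : ℕ → ℝ[X]
  | 0 => 1
  | 1 => C (1 / (1 + s)) * (X - C s)
  | n + 2 => C (1 / (n + 2 + s)) *
      (C (2 * n + 3 : ℝ) * X * fracLegendre s (n + 1) - C (n + 1 - s) * fracLegendre s n)

/-- `(1 + y) ^ s * fracLegendre s n`. -/
noncomputable def fracF (s : ℝ) (n : ℕ) (y : ℝ) : ℝ :=
  (1 + y) ^ s * (fracLegendre s n).eval y

/-- The first-order expression appearing in the derivative of `fracF`. -/
noncomputable def fracE (s : ℝ) (n : ℕ) (y : ℝ) : ℝ :=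
  s * (fracLegendre s n).eval y + (1 + y) * (fracLegendre s n).derivative.eval y

/-- The derivative of `fracF`. -/
noncomputable def fracD (s : ℝ) (n : ℕ) (y : ℝ) : ℝ :=
  (1 + y) ^ (s - 1) * fracE s n y

lemma fracLegendre_rec {s : ℝ} (hs : 0 ≤ s) (n : ℕ) (y : ℝ) :
    (n + 2 + s) * (fracLegendre s (n + 2)).eval y =
      (2 * n + 3) * y * (fracLegendre s (n + 1)).eval y
        - (n + 1 - s) * (fracLegendre s n).eval y := by
  have h : (n + 2 + s : ℝ) ≠ 0 := by positivity
  simp only [fracLegendre, Polynomial.eval_mul, Polynomial.eval_C, Polynomial.eval_sub,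
    Polynomial.eval_X]
  field_simp

lemma fracLegendre_rec_deriv {s : ℝ} (hs : 0 ≤ s) (n : ℕ) (y : ℝ) :
    (n + 2 + s) * (fracLegendre s (n + 2)).derivative.eval y =
      (2 * n + 3) * ((fracLegendre s (n + 1)).eval y +
        y * (fracLegendre s (n + 1)).derivative.eval y)
        - (n + 1 - s) * (fracLegendre s n).derivative.eval y := by
  have h : (n + 2 + s : ℝ) ≠ 0 := by positivity
  simp only [fracLegendre, Polynomial.derivative_mul, Polynomial.derivative_C,
    Polynomial.derivative_sub, Polynomial.derivative_X, Polynomial.eval_mul, Polynomial.eval_C,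
    Polynomial.eval_sub, Polynomial.eval_add, Polynomial.eval_X, Polynomial.eval_one,
    Polynomial.eval_zero]
  field_simp
  ring

lemma fracE_zero (s y : ℝ) : fracE s 0 y = s := by
  simp [fracE, fracLegendre]

lemma fracE_rec {s : ℝ} (hs : 0 ≤ s) (n : ℕ) (y : ℝ) :
    (n + 2 + s) * fracE s (n + 2) y =
      (2 * n + 3) * ((1 + y) * (fracLegendre s (n + 1)).eval y + y * fracE s (n + 1) y)
        - (n + 1 - s) * fracE s n y := by
  have h1 := fracLegendre_rec hs n y
  have h2 := fracLegendre_rec_deriv hs n y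
  simp only [fracE]
  linear_combination s * h1 + (1 + y) * h2

lemma fracE_relations {s : ℝ} (hs : 0 ≤ s) (n : ℕ) (y : ℝ) :
    fracE s (n + 1) y = y * fracE s n y + (n + 1 - s) * ((1 + y) * (fracLegendre s n).eval y) ∧
    y * fracE s (n + 1) y - fracE s n y =
      (n + 1 + s) * ((1 + y) * (fracLegendre s (n + 1)).eval y) := by
  induction n with
  | zero =>
    have h : (1 + s : ℝ) ≠ 0 := by positivity
    constructor
    · simp [fracE, fracLegendre]; field_simp; ring
    · simp [fracE, fracLegendre]; field_simp; ring
  | succ n ih =>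
    obtain ⟨h1, h2⟩ := ih
    have hr := fracE_rec hs n y
    have hq := fracLegendre_rec hs n y
    have h : (n + 2 + s : ℝ) ≠ 0 := by positivity
    push_cast
    have h3 : fracE s (n + 1 + 1) y = y * fracE s (n + 1) y +
        (n + 1 + 1 - s) * ((1 + y) * (fracLegendre s (n + 1)).eval y) := by
      apply mul_left_cancel₀ h
      linear_combination hr + (n + 1 - s) * h2
    refine ⟨h3, ?_⟩
    rw [h3]
    linear_combination y * h2 - h1 - (1 + y) * hq

lemma fracE_sub {s : ℝ} (hs : 0 ≤ s) (n : ℕ) (y : ℝ) :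
    fracE s (n + 2) y - fracE s n y =
      (2 * n + 3) * ((1 + y) * (fracLegendre s (n + 1)).eval y) := by
  have h1 := (fracE_relations hs (n + 1) y).1
  have h2 := (fracE_relations hs n y).2
  push_cast at h1
  linear_combination h1 + h2

lemma rpow_sub_one_mul {s x : ℝ} (hx : 0 < x) : x ^ s = x ^ (s - 1) * x := by
  rw [Real.rpow_sub_one hx.ne']; field_simp

lemma hasDerivAt_fracF (s : ℝ) (n : ℕ) {y : ℝ} (hy : -1 < y) :
    HasDerivAt (fracF s n) (fracD s n y) y := by
  have h : 0 < 1 + y := by linarith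
  have h1 : HasDerivAt (fun y : ℝ => (1 + y) ^ s) (1 * s * (1 + y) ^ (s - 1)) y :=
    ((hasDerivAt_id y).const_add 1).rpow_const (Or.inl h.ne')
  have h2 := h1.mul ((fracLegendre s n).hasDerivAt y)
  refine h2.congr_deriv ?_
  simp only [fracD, fracE]
  rw [rpow_sub_one_mul (s := s) h]
  ring

lemma fracD_relations {s : ℝ} (hs : 0 ≤ s) (n : ℕ) {y : ℝ} (hy : -1 < y) :
    fracD s (n + 1) y = y * fracD s n y + (n + 1 - s) * fracF s n y ∧
    y * fracD s (n + 1) y - fracD s n y = (n + 1 + s) * fracF s (n + 1) y := by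
  obtain ⟨h1, h2⟩ := fracE_relations hs n y
  have h : 0 < 1 + y := by linarith
  simp only [fracD, fracF]
  rw [rpow_sub_one_mul (s := s) h]
  constructor
  · rw [h1]; ring
  · linear_combination (1 + y) ^ (s - 1) * h2

lemma fracD_sub {s : ℝ} (hs : 0 ≤ s) (n : ℕ) {y : ℝ} (hy : -1 < y) :
    fracD s (n + 2) y - fracD s n y = (2 * n + 3) * fracF s (n + 1) y := by
  have h1 := (fracD_relations hs (n + 1) hy).1
  have h2 := (fracD_relations hs n hy).2
  push_cast at h1
  linear_combination h1 + h2

lemma fracD_closed {s : ℝ} (hs : 0 ≤ s) (n : ℕ) {y : ℝ} (hy : -1 < y) :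
    (y ^ 2 - 1) * fracD s (n + 1) y = (n + 1 + s) * y * fracF s (n + 1) y
      - (n + 1 - s) * fracF s n y := by
  obtain ⟨h1, h2⟩ := fracD_relations hs n hy
  linear_combination y * h2 - h1

lemma fracF_rec {s : ℝ} (hs : 0 ≤ s) (n : ℕ) (y : ℝ) :
    (n + 2 + s) * fracF s (n + 2) y =
      (2 * n + 3) * y * fracF s (n + 1) y - (n + 1 - s) * fracF s n y := by
  have := fracLegendre_rec hs n y
  simp only [fracF]
  linear_combination (1 + y) ^ s * this

/-- The Sonine function of the differential equation satisfied by `fracF s n`. -/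
noncomputable def sonine (s : ℝ) (n : ℕ) (y : ℝ) : ℝ :=
  fracF s n y ^ 2 + (1 - y ^ 2) * fracD s n y ^ 2 / ((n + s) * (n + 1 - s))

lemma hasDerivAt_sonine {s : ℝ} (hs : 0 ≤ s) {n : ℕ} (hn : 1 ≤ n) (hsn : s < n + 1)
    {y : ℝ} (hy : y ∈ Ioo (-1 : ℝ) 1) :
    HasDerivAt (sonine s n)
      (2 * (1 - 2 * s) * y * fracD s n y ^ 2 / ((n + s) * (n + 1 - s))) y := by
  obtain ⟨n, rfl⟩ : ∃ k, n = k + 1 := ⟨n - 1, by omega⟩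
  push_cast at hsn ⊢
  have hM1 : (n + 1 + s : ℝ) ≠ 0 := by positivity
  have hM2 : (n + 1 + 1 - s : ℝ) ≠ 0 := by linarith
  have hF := hasDerivAt_fracF s (n + 1) hy.1
  have hF0 := hasDerivAt_fracF s n hy.1
  have hy2 : (1 - y ^ 2 : ℝ) ≠ 0 := by nlinarith [hy.1, hy.2]
  obtain ⟨h1, h2⟩ := fracD_relations hs n hy.1
  have hloc : sonine s (n + 1) =ᶠ[nhds y] fun y => fracF s (n + 1) y ^ 2 +
      ((n + 1 + s) * y * fracF s (n + 1) y - (n + 1 - s) * fracF s n y) ^ 2 / (1 - y ^ 2) /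
        ((n + 1 + s) * (n + 1 + 1 - s)) := by
    filter_upwards [isOpen_Ioo.mem_nhds hy] with z hz
    have hz2 : (1 - z ^ 2 : ℝ) ≠ 0 := by nlinarith [hz.1, hz.2]
    rw [sonine, ← fracD_closed hs n hz.1]
    push_cast
    congr 1
    field_simp
    ring
  refine HasDerivAt.congr_of_eventuallyEq ?_ hloc
  have hV : HasDerivAt (fun y => (n + 1 + s) * y * fracF s (n + 1) y - (n + 1 - s) * fracF s n y)
      ((n + 1 + s) * fracF s (n + 1) y + (n + 1 + s) * y * fracD s (n + 1) y
        - (n + 1 - s) * fracD s n y) y := by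
    have h3 := (((hasDerivAt_id y).const_mul (n + 1 + s : ℝ)).mul hF).sub
      (hF0.const_mul (n + 1 - s : ℝ))
    refine h3.congr_deriv ?_
    simp
  have hW : HasDerivAt (fun y : ℝ => 1 - y ^ 2) (-(2 * y)) y := by
    refine (((hasDerivAt_id y).pow 2).const_sub 1).congr_deriv ?_
    simp
  have h4 := (hF.pow 2).add (((hV.pow 2).div hW hy2).div_const
    ((n + 1 + s) * (n + 1 + 1 - s)))
  refine h4.congr_deriv ?_
  have hV' : (n + 1 + s) * fracF s (n + 1) y + (n + 1 + s) * y * fracD s (n + 1) y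
        - (n + 1 - s) * fracD s n y = 2 * s * y * fracD s (n + 1) y +
        (n + 1 + s) * (n + 1 + 1 - s) * fracF s (n + 1) y := by
    linear_combination (n + 1 - s) * h2
  have hc := fracD_closed hs n hy.1
  simp only [Nat.cast_ofNat, Nat.add_one_sub_one, pow_one, Pi.pow_apply]
  rw [hV', ← hc]
  field_simp
  ring

lemma continuousOn_sonine (s : ℝ) (n : ℕ) : ContinuousOn (sonine s n) (Ioi (-1)) := by
  have h : ∀ r : ℝ, ContinuousOn (fun y : ℝ => (1 + y) ^ r) (Ioi (-1)) := fun r =>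
    ContinuousOn.rpow_const (by fun_prop) fun y hy => Or.inl (by
      simp only [mem_Ioi] at hy; linarith)
  have hF : ContinuousOn (fracF s n) (Ioi (-1)) :=
    (h s).mul (fracLegendre s n).continuous.continuousOn
  have hD : ContinuousOn (fracD s n) (Ioi (-1)) := by
    refine (h (s - 1)).mul ?_
    unfold fracE
    exact ((((fracLegendre s n).continuous.const_mul s)).add
      ((continuous_const.add continuous_id).mul
        (fracLegendre s n).derivative.continuous)).continuousOn
  unfold sonine
  exact (hF.pow 2).add (((by fun_prop : ContinuousOn (fun y : ℝ => 1 - y ^ 2) _).mul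
    (hD.pow 2)).div_const _)

lemma sonine_deriv_factor_nonneg {s : ℝ} (hs : 0 ≤ s) {n : ℕ} (hsn : s < n + 1) (y : ℝ) :
    0 ≤ fracD s n y ^ 2 / ((n + s) * (n + 1 - s)) := by
  have : (0 : ℝ) ≤ n + 1 - s := by linarith
  positivity

/-- For `s ≥ 1/2` the Sonine function is largest at the origin. -/
lemma sonine_le_zero {s : ℝ} (hs : 1 / 2 ≤ s) {n : ℕ} (hn : 1 ≤ n) (hsn : s < n + 1)
    {y : ℝ} (hy : y ∈ Ioc (-1 : ℝ) 1) : sonine s n y ≤ sonine s n 0 := by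
  have hs0 : 0 ≤ s := by linarith
  rcases le_total 0 y with h | h
  · have : AntitoneOn (sonine s n) (Icc 0 1) := by
      apply antitoneOn_of_hasDerivWithinAt_nonpos (convex_Icc 0 1)
        ((continuousOn_sonine s n).mono fun z hz => by simp only [mem_Ioi]; linarith [hz.1])
        (f' := fun y => 2 * (1 - 2 * s) * y * fracD s n y ^ 2 / ((n + s) * (n + 1 - s)))
      · intro z hz
        rw [interior_Icc] at hz
        exact (hasDerivAt_sonine hs0 hn hsn ⟨by linarith [hz.1], hz.2⟩).hasDerivWithinAt
      · intro z hz
        rw [interior_Icc] at hz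
        have := sonine_deriv_factor_nonneg hs0 hsn z
        rw [mul_div_assoc]
        exact mul_nonpos_of_nonpos_of_nonneg (by nlinarith [hz.1]) this
    exact this ⟨le_rfl, zero_le_one⟩ ⟨h, hy.2⟩ h
  · have : MonotoneOn (sonine s n) (Icc y 0) := by
      apply monotoneOn_of_hasDerivWithinAt_nonneg (convex_Icc y 0)
        ((continuousOn_sonine s n).mono fun z hz => by simp only [mem_Ioi]; linarith [hz.1, hy.1])
        (f' := fun y => 2 * (1 - 2 * s) * y * fracD s n y ^ 2 / ((n + s) * (n + 1 - s)))
      · intro z hz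
        rw [interior_Icc] at hz
        exact (hasDerivAt_sonine hs0 hn hsn ⟨by linarith [hz.1, hy.1], by linarith [hz.2]⟩).hasDerivWithinAt
      · intro z hz
        rw [interior_Icc] at hz
        have := sonine_deriv_factor_nonneg hs0 hsn z
        rw [mul_div_assoc]
        exact mul_nonneg (by nlinarith [hz.2]) this
    exact this ⟨le_rfl, h⟩ ⟨h, le_rfl⟩ h

/-- For `s ≤ 1/2` the Sonine function grows away from the origin. -/
lemma sonine_le_of_le_half {s : ℝ} (hs0 : 0 ≤ s) (hs : s ≤ 1 / 2) {n : ℕ} (hn : 1 ≤ n)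
    {y : ℝ} (hy : y ∈ Icc (0 : ℝ) 1) : sonine s n y ≤ sonine s n 1 := by
  have hsn : s < n + 1 := by have : (0 : ℝ) ≤ n := n.cast_nonneg; linarith
  have : MonotoneOn (sonine s n) (Icc 0 1) := by
    apply monotoneOn_of_hasDerivWithinAt_nonneg (convex_Icc 0 1)
      ((continuousOn_sonine s n).mono fun z hz => by simp only [mem_Ioi]; linarith [hz.1])
      (f' := fun y => 2 * (1 - 2 * s) * y * fracD s n y ^ 2 / ((n + s) * (n + 1 - s)))
    · intro z hz
      rw [interior_Icc] at hz
      exact (hasDerivAt_sonine hs0 hn hsn ⟨by linarith [hz.1], hz.2⟩).hasDerivWithinAt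
    · intro z hz
      rw [interior_Icc] at hz
      have := sonine_deriv_factor_nonneg hs0 hsn z
      rw [mul_div_assoc]
      exact mul_nonneg (by nlinarith [hz.1]) this
  exact this hy ⟨zero_le_one, le_rfl⟩ hy.2

lemma sonine_le_left_of_le_half {s : ℝ} (hs0 : 0 ≤ s) (hs : s ≤ 1 / 2) {n : ℕ} (hn : 1 ≤ n)
    {x y : ℝ} (hx : -1 < x) (hxy : x ≤ y) (hy : y ≤ 0) : sonine s n y ≤ sonine s n x := by
  have hsn : s < n + 1 := by have : (0 : ℝ) ≤ n := n.cast_nonneg; linarith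
  have : AntitoneOn (sonine s n) (Icc x 0) := by
    apply antitoneOn_of_hasDerivWithinAt_nonpos (convex_Icc x 0)
      ((continuousOn_sonine s n).mono fun z hz => by simp only [mem_Ioi]; linarith [hz.1])
      (f' := fun y => 2 * (1 - 2 * s) * y * fracD s n y ^ 2 / ((n + s) * (n + 1 - s)))
    · intro z hz
      rw [interior_Icc] at hz
      exact (hasDerivAt_sonine hs0 hn hsn
        ⟨by linarith [hz.1], by linarith [hz.2]⟩).hasDerivWithinAt
    · intro z hz
      rw [interior_Icc] at hz
      have := sonine_deriv_factor_nonneg hs0 hsn z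
      rw [mul_div_assoc]
      exact mul_nonpos_of_nonpos_of_nonneg
        (mul_nonpos_of_nonneg_of_nonpos (by linarith) hz.2.le) this
  exact this ⟨le_rfl, hxy.trans hy⟩ ⟨hxy, hy⟩ hxy

lemma sq_fracF_le_sonine {s : ℝ} (hs : 0 ≤ s) {n : ℕ} (hsn : s < n + 1)
    {y : ℝ} (hy : y ∈ Icc (-1 : ℝ) 1) : fracF s n y ^ 2 ≤ sonine s n y := by
  have h1 := sonine_deriv_factor_nonneg hs hsn y
  have h2 : 0 ≤ 1 - y ^ 2 := by nlinarith [hy.1, hy.2]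
  rw [sonine, mul_div_assoc]
  nlinarith [mul_nonneg h2 h1]

/-- The Legendre polynomials. -/
noncomputable def legendreP (n : ℕ) : Polynomial ℝ := fracLegendre 0 n

lemma legendreP_rec (n : ℕ) (y : ℝ) :
    (n + 2) * (legendreP (n + 2)).eval y =
      (2 * n + 3) * y * (legendreP (n + 1)).eval y - (n + 1) * (legendreP n).eval y := by
  have := fracLegendre_rec le_rfl n y
  simp only [add_zero, sub_zero] at this
  exact this

@[simp] lemma legendreP_zero : legendreP 0 = 1 := rfl

@[simp] lemma legendreP_one : legendreP 1 = Polynomial.X := by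
  simp [legendreP, fracLegendre]

lemma legendreP_deriv_sub (n : ℕ) :
    (legendreP (n + 2)).derivative - (legendreP n).derivative =
      Polynomial.C (2 * n + 3 : ℝ) * legendreP (n + 1) := by
  have h : (Polynomial.X + Polynomial.C (1 : ℝ)) ≠ 0 := Polynomial.X_add_C_ne_zero 1
  apply mul_left_cancel₀ h
  apply Polynomial.funext
  intro y
  have := fracE_sub le_rfl n y
  simp only [fracE] at this
  simp only [legendreP, Polynomial.eval_mul, Polynomial.eval_add, Polynomial.eval_sub,
    Polynomial.eval_X, Polynomial.eval_C]
  linear_combination this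

lemma legendreP_eval_one (n : ℕ) : (legendreP n).eval 1 = 1 := by
  induction n using Nat.twoStepInduction with
  | zero => simp
  | one => simp
  | more n h1 h2 =>
    have := legendreP_rec n 1
    rw [h1, h2] at this
    have h : (n + 2 : ℝ) ≠ 0 := by positivity
    apply mul_left_cancel₀ h
    linear_combination this

lemma legendreP_eval_neg (n : ℕ) (y : ℝ) :
    (legendreP n).eval (-y) = (-1) ^ n * (legendreP n).eval y := by
  induction n using Nat.twoStepInduction with
  | zero => simp
  | one => simp
  | more n h1 h2 =>
    have h3 := legendreP_rec n (-y)
    have h4 := legendreP_rec n y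
    rw [h1, h2] at h3
    have h : (n + 2 : ℝ) ≠ 0 := by positivity
    apply mul_left_cancel₀ h
    rw [h3]
    have : (n + 2) * ((-1) ^ (n + 2) * (legendreP (n + 2)).eval y) =
      (-1) ^ n * ((n + 2) * (legendreP (n + 2)).eval y) := by ring
    rw [this, h4]
    ring

lemma legendreP_eval_neg_one (n : ℕ) : (legendreP n).eval (-1) = (-1) ^ n := by
  rw [legendreP_eval_neg, legendreP_eval_one, mul_one]

lemma abs_legendreP_le_one (n : ℕ) {y : ℝ} (hy : y ∈ Icc (-1 : ℝ) 1) :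
    |(legendreP n).eval y| ≤ 1 := by
  rcases Nat.eq_zero_or_pos n with rfl | hn
  · simp
  have key : ∀ z ∈ Icc (0 : ℝ) 1, |(legendreP n).eval z| ≤ 1 := by
    intro z hz
    have hF : ∀ x, fracF 0 n x = (legendreP n).eval x := fun x => by simp [fracF, legendreP]
    have h1 := sonine_le_of_le_half le_rfl (by norm_num) hn hz
    have h2 := sq_fracF_le_sonine le_rfl (n := n) (by positivity)
      (y := z) ⟨by linarith [hz.1], hz.2⟩
    have h3 : sonine 0 n 1 = 1 := by simp [sonine, hF, legendreP_eval_one]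
    rw [hF] at h2
    exact abs_le_one_iff_mul_self_le_one.mpr (by nlinarith)
  rcases le_total 0 y with h | h
  · exact key y ⟨h, hy.2⟩
  · have := key (-y) ⟨by linarith, by linarith [hy.1]⟩
    rwa [legendreP_eval_neg, abs_mul, abs_pow, abs_neg, abs_one, one_pow, one_mul] at this

lemma intervalIntegrable_sub_rpow {s : ℝ} (hs : -1 < s) (a b c : ℝ) :
    IntervalIntegrable (fun t : ℝ => (c - t) ^ s) volume a b := by
  have h := (intervalIntegral.intervalIntegrable_rpow' (a := c - a) (b := c - b) hs)
  simpa using h.comp_sub_left c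

lemma intervalIntegrable_sub_rpow_mul {s : ℝ} (hs : -1 < s) (a b c : ℝ) (P : Polynomial ℝ) :
    IntervalIntegrable (fun t : ℝ => (c - t) ^ s * P.eval t) volume a b :=
  (intervalIntegrable_sub_rpow hs a b c).mul_continuousOn P.continuous.continuousOn

/-- Integration by parts against a one-sided power. -/
lemma integral_sub_rpow_mul_derivative {s : ℝ} (hs : 0 < s) {a τ : ℝ} (hτ : a ≤ τ)
    (P : Polynomial ℝ) :
    ∫ t in a..τ, (τ - t) ^ s * P.derivative.eval t =
      s * (∫ t in a..τ, (τ - t) ^ (s - 1) * P.eval t) - (τ - a) ^ s * P.eval a := by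
  have hi1 := intervalIntegrable_sub_rpow_mul (s := s) (by linarith) a τ τ P.derivative
  have hi2 := intervalIntegrable_sub_rpow_mul (s := s - 1) (by linarith) a τ τ P
  have h := intervalIntegral.integral_eq_sub_of_hasDerivAt_of_le hτ
    (f := fun t => (τ - t) ^ s * P.eval t)
    (f' := fun t => (τ - t) ^ s * P.derivative.eval t - s * ((τ - t) ^ (s - 1) * P.eval t))
    ?_ ?_ (hi1.sub (hi2.const_mul s))
  · rw [intervalIntegral.integral_sub hi1 (hi2.const_mul s),
      intervalIntegral.integral_const_mul] at h
    simp only [sub_self, Real.zero_rpow hs.ne', zero_mul, zero_sub] at h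
    linarith
  · exact (ContinuousOn.rpow_const (by fun_prop) fun _ _ => Or.inr hs.le).mul
      P.continuous.continuousOn
  · intro t ht
    have h0 : τ - t ≠ 0 := by linarith [ht.2]
    have h1 : HasDerivAt (fun t : ℝ => (τ - t) ^ s) (-1 * s * (τ - t) ^ (s - 1)) t :=
      ((hasDerivAt_id t).const_sub τ).rpow_const (Or.inl h0)
    refine (h1.mul (P.hasDerivAt t)).congr_deriv ?_
    ring

/-- Multiplication by the variable, expressed through a one-sided power of higher order. -/
lemma integral_sub_rpow_mul_X {s : ℝ} (hs : 0 < s) {a τ : ℝ} (hτ : a ≤ τ) (P : Polynomial ℝ) :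
    ∫ t in a..τ, (τ - t) ^ (s - 1) * (t * P.eval t) =
      τ * (∫ t in a..τ, (τ - t) ^ (s - 1) * P.eval t) - ∫ t in a..τ, (τ - t) ^ s * P.eval t := by
  have hi1 := intervalIntegrable_sub_rpow_mul (s := s) (by linarith) a τ τ P
  have hi2 := intervalIntegrable_sub_rpow_mul (s := s - 1) (by linarith) a τ τ P
  rw [← intervalIntegral.integral_const_mul, ← intervalIntegral.integral_sub
    (hi2.const_mul τ) hi1]
  apply intervalIntegral.integral_congr
  intro t ht
  rw [uIcc_of_le hτ] at ht
  rcases eq_or_lt_of_le ht.2 with h | h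
  · subst h; simp [Real.zero_rpow hs.ne']; ring
  · have : (τ - t) ^ s = (τ - t) ^ (s - 1) * (τ - t) := rpow_sub_one_mul (by linarith)
    simp only [this]
    ring

lemma integral_sub_rpow {s : ℝ} (hs : 0 < s) (a τ : ℝ) :
    ∫ t in a..τ, (τ - t) ^ (s - 1) = (τ - a) ^ s / s := by
  rw [intervalIntegral.integral_comp_sub_left (fun x : ℝ => x ^ (s - 1)) τ,
    integral_rpow (Or.inl (by linarith))]
  simp [Real.zero_rpow hs.ne']

/-- The fractional integral of a Legendre polynomial. -/
lemma integral_sub_rpow_mul_legendreP {s : ℝ} (hs : 0 < s) (n : ℕ) {τ : ℝ} (hτ : -1 ≤ τ) :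
    ∫ t in (-1 : ℝ)..τ, (τ - t) ^ (s - 1) * (legendreP n).eval t = fracF s n τ / s := by
  induction n using Nat.twoStepInduction with
  | zero =>
    simp only [legendreP_zero, Polynomial.eval_one, mul_one, fracF, fracLegendre]
    rw [integral_sub_rpow hs]
    ring_nf
  | one =>
    have h := integral_sub_rpow_mul_X hs hτ 1
    have h2 := integral_sub_rpow (s := s + 1) (by linarith) (-1) τ
    simp only [add_sub_cancel_right] at h2
    simp only [Polynomial.eval_one, mul_one] at h
    simp only [legendreP_one, Polynomial.eval_X]
    rw [h, integral_sub_rpow hs, h2]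
    have h3 : (τ - -1) ^ (s + 1) = (τ - -1) ^ s * (τ - -1) :=
      Real.rpow_add_one' (by linarith) (by linarith)
    have h4 : (1 + s) ≠ 0 := by linarith
    rw [h3]
    simp only [fracF, fracLegendre, Polynomial.eval_mul, Polynomial.eval_C, Polynomial.eval_sub,
      Polynomial.eval_X]
    rw [show τ - -1 = 1 + τ by ring, show s + 1 = 1 + s by ring]
    field_simp
    ring
  | more n h1 h2 =>
    set J : ℝ → Polynomial ℝ → ℝ :=
      fun r P => ∫ t in (-1 : ℝ)..τ, (τ - t) ^ r * P.eval t with hJ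
    have hi := fun (r : ℝ) (hr : -1 < r) (P : Polynomial ℝ) =>
      intervalIntegrable_sub_rpow_mul hr (-1) τ τ P
    have hb := integral_sub_rpow_mul_derivative hs hτ (legendreP (n + 2) - legendreP n)
    have hx := integral_sub_rpow_mul_X hs hτ (legendreP (n + 1))
    rw [Polynomial.derivative_sub, legendreP_deriv_sub] at hb
    have e1 : ∫ t in (-1 : ℝ)..τ, (τ - t) ^ s *
        (Polynomial.C (2 * n + 3 : ℝ) * legendreP (n + 1)).eval t =
        (2 * n + 3) * J s (legendreP (n + 1)) := by
      rw [hJ, ← intervalIntegral.integral_const_mul]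
      congr 1; ext t; simp; ring
    have e2 : ∫ t in (-1 : ℝ)..τ, (τ - t) ^ (s - 1) *
        (legendreP (n + 2) - legendreP n).eval t =
        J (s - 1) (legendreP (n + 2)) - J (s - 1) (legendreP n) := by
      rw [hJ, ← intervalIntegral.integral_sub (hi _ (by linarith) _) (hi _ (by linarith) _)]
      congr 1; ext t; simp; ring
    have e3 : (n + 2) * J (s - 1) (legendreP (n + 2)) =
        (2 * n + 3) * (∫ t in (-1 : ℝ)..τ, (τ - t) ^ (s - 1) * (t * (legendreP (n + 1)).eval t))
        - (n + 1) * J (s - 1) (legendreP n) := by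
      have hi3 : IntervalIntegrable
          (fun t => (τ - t) ^ (s - 1) * (t * (legendreP (n + 1)).eval t)) volume (-1) τ := by
        have := hi (s - 1) (by linarith) (Polynomial.X * legendreP (n + 1))
        simpa using this
      rw [hJ, ← intervalIntegral.integral_const_mul, ← intervalIntegral.integral_const_mul,
        ← intervalIntegral.integral_const_mul, ← intervalIntegral.integral_sub
          (hi3.const_mul _) ((hi _ (by linarith) _).const_mul _)]
      congr 1; ext t
      linear_combination (τ - t) ^ (s - 1) * legendreP_rec n t
    rw [e1, e2, Polynomial.eval_sub, legendreP_eval_neg_one, legendreP_eval_neg_one] at hb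
    have hF := fracF_rec hs.le n τ
    have h1' : J (s - 1) (legendreP n) = fracF s n τ / s := h1
    have h2' : J (s - 1) (legendreP (n + 1)) = fracF s (n + 1) τ / s := h2
    change J (s - 1) (legendreP (n + 2)) = _
    have hx' : ∫ t in (-1 : ℝ)..τ, (τ - t) ^ (s - 1) * (t * (legendreP (n + 1)).eval t) =
      τ * J (s - 1) (legendreP (n + 1)) - J s (legendreP (n + 1)) := hx
    rw [hx'] at e3
    have hpos : (n + 2 + s : ℝ) ≠ 0 := by positivity
    apply mul_left_cancel₀ hpos
    rw [mul_div_assoc', hF]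
    field_simp
    rw [eq_div_iff hs.ne'] at h1' h2'
    rw [← h1', ← h2']
    have : (-1 : ℝ) ^ (n + 2) = (-1) ^ n := by ring
    rw [this] at hb
    linear_combination s * e3 - s * hb

lemma abs_fracF_le {s : ℝ} (hs : 0 < s) (n : ℕ) {τ : ℝ} (hτ : τ ∈ Icc (-1 : ℝ) 1) :
    |fracF s n τ| ≤ (1 + τ) ^ s := by
  have h := integral_sub_rpow_mul_legendreP hs n hτ.1
  have h1 : |∫ t in (-1 : ℝ)..τ, (τ - t) ^ (s - 1) * (legendreP n).eval t| ≤
      ∫ t in (-1 : ℝ)..τ, (τ - t) ^ (s - 1) := by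
    rw [← Real.norm_eq_abs]
    refine intervalIntegral.norm_integral_le_of_norm_le hτ.1 (Eventually.of_forall ?_)
      (intervalIntegrable_sub_rpow (s := s - 1) (by linarith) _ _ _)
    intro t ht
    have h0 : 0 ≤ (τ - t) ^ (s - 1) := Real.rpow_nonneg (by linarith [ht.2]) _
    rw [norm_mul, Real.norm_of_nonneg h0]
    exact mul_le_of_le_one_right h0
      (abs_legendreP_le_one n ⟨ht.1.le, ht.2.trans hτ.2⟩)
  rw [h, integral_sub_rpow hs, abs_div, abs_of_pos hs, div_le_div_iff_of_pos_right hs] at h1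
  rwa [show τ - -1 = 1 + τ by ring] at h1

/-- A sequence whose step ratio is `1 - c / n + …` decays like a power. -/
lemma exists_rpow_decay {a : ℕ → ℝ} {c d : ℝ} {j N : ℕ} (hj : 1 ≤ j) (hc : 0 < c) (hd : 1 ≤ d)
    (h : ∀ n ≥ N, |a (n + j)| ≤ (1 - c / (n + d)) * |a n|) :
    ∃ C > (0 : ℝ), ∀ n : ℕ, 1 ≤ n → |a n| ≤ C * (n : ℝ) ^ (-(c / j)) := by
  have hj0 : (0 : ℝ) < j := by exact_mod_cast hj
  set b : ℕ → ℝ := fun n => |a n| * ((n : ℝ) + d) ^ (c / j) with hb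
  have hb0 : ∀ n, 0 ≤ b n := fun n => by positivity
  have hstep : ∀ n ≥ N, b (n + j) ≤ b n := by
    intro n hn
    have hx : (0 : ℝ) < n + d := by positivity
    have h1 := h n hn
    have h2 : ((n + j : ℕ) + d : ℝ) ^ (c / j) ≤ Real.exp (c / (n + d)) * (n + d) ^ (c / j) := by
      have e : ((n + j : ℕ) + d : ℝ) = (1 + j / (n + d)) * (n + d) := by
        push_cast; field_simp; ring
      rw [e, Real.mul_rpow (by positivity) hx.le]
      gcongr
      calc (1 + j / (n + d) : ℝ) ^ (c / j) ≤ (Real.exp (j / (n + d))) ^ (c / j) := by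
            gcongr
            have := Real.add_one_le_exp (j / (n + d) : ℝ)
            linarith
        _ = Real.exp (c / (n + d)) := by
            rw [← Real.exp_mul]; congr 1; field_simp
    have h3 : 1 - c / (n + d) ≤ Real.exp (-(c / (n + d))) := by
      have := Real.add_one_le_exp (-(c / (n + d) : ℝ)); linarith
    have h4 : |a (n + j)| ≤ Real.exp (-(c / (n + d))) * |a n| :=
      h1.trans (by gcongr)
    calc b (n + j) ≤ (Real.exp (-(c / (n + d))) * |a n|) *
          (Real.exp (c / (n + d)) * (n + d) ^ (c / j)) := by
          simp only [hb]; gcongr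
      _ = (Real.exp (-(c / (n + d))) * Real.exp (c / (n + d))) * b n := by simp only [hb]; ring
      _ = b n := by rw [← Real.exp_add]; simp
  set K : ℝ := ∑ i ∈ Finset.range (N + j), b i with hK
  have hbK : ∀ n, b n ≤ K := by
    intro n
    induction n using Nat.strong_induction_on with
    | _ n ih =>
      by_cases hn : n < N + j
      · exact Finset.single_le_sum (f := b) (fun i _ => hb0 i) (Finset.mem_range.mpr hn)
      · have := hstep (n - j) (by omega)
        rw [Nat.sub_add_cancel (by omega)] at this
        exact this.trans (ih (n - j) (by omega))
  have hK0 : 0 ≤ K := (hb0 0).trans (hbK 0)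
  refine ⟨K + 1, by linarith, fun n hn => ?_⟩
  have hn0 : (0 : ℝ) < n := by exact_mod_cast hn
  have h1 : |a n| * (n : ℝ) ^ (c / j) ≤ K + 1 := by
    calc |a n| * (n : ℝ) ^ (c / j) ≤ b n := by
          simp only [hb]; gcongr; linarith
      _ ≤ K + 1 := by linarith [hbK n]
  rw [Real.rpow_neg hn0.le, ← div_eq_mul_inv, le_div_iff₀ (by positivity)]
  exact h1

lemma exists_abs_fracF_zero_le {s : ℝ} (hs : 0 ≤ s) :
    ∃ C > (0 : ℝ), ∀ n : ℕ, 1 ≤ n → |fracF s n 0| ≤ C * (n : ℝ) ^ (-(s + 1 / 2)) := by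
  obtain ⟨C, hC, h⟩ := exists_rpow_decay (a := fun n => fracF s n 0) (c := 2 * s + 1)
    (d := 2 + s) (j := 2) (N := ⌈s⌉₊) (by norm_num) (by linarith) (by linarith) (by
      intro n hn
      have hn' : s ≤ n := Nat.ceil_le.mp hn
      have h := fracF_rec hs n 0
      have hp : (0 : ℝ) < n + 2 + s := by positivity
      have e : fracF s (n + 2) 0 = -((1 - (2 * s + 1) / (n + (2 + s))) * fracF s n 0) := by
        apply mul_left_cancel₀ hp.ne'
        rw [h]
        field_simp
        ring
      have h0 : 0 ≤ 1 - (2 * s + 1) / (n + (2 + s)) := by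
        rw [sub_nonneg, div_le_one (by linarith)]; linarith
      rw [e, abs_neg, abs_mul, abs_of_nonneg h0])
  refine ⟨C, hC, fun n hn => ?_⟩
  have := h n hn
  rwa [show (2 * s + 1) / ((2 : ℕ) : ℝ) = s + 1 / 2 by push_cast; ring] at this

lemma fracF_one_succ {s : ℝ} (hs : 0 ≤ s) (n : ℕ) :
    (n + 1 + s) * fracF s (n + 1) 1 = (n + 1 - s) * fracF s n 1 := by
  have h := fracD_closed hs n (y := 1) (by norm_num)
  linear_combination -h

lemma exists_abs_fracF_one_le {s : ℝ} (hs : 0 < s) :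
    ∃ C > (0 : ℝ), ∀ n : ℕ, 1 ≤ n → |fracF s n 1| ≤ C * (n : ℝ) ^ (-(2 * s)) := by
  obtain ⟨C, hC, h⟩ := exists_rpow_decay (a := fun n => fracF s n 1) (c := 2 * s)
    (d := 1 + s) (j := 1) (N := ⌈s⌉₊) (by norm_num) (by linarith) (by linarith) (by
      intro n hn
      have hn' : s ≤ n := Nat.ceil_le.mp hn
      have h := fracF_one_succ hs.le n
      have hp : (0 : ℝ) < n + 1 + s := by positivity
      have e : fracF s (n + 1) 1 = (1 - 2 * s / (n + (1 + s))) * fracF s n 1 := by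
        apply mul_left_cancel₀ hp.ne'
        rw [h]
        field_simp
        ring
      have h0 : 0 ≤ 1 - 2 * s / (n + (1 + s)) := by
        rw [sub_nonneg, div_le_one (by linarith)]; linarith
      rw [e, abs_mul, abs_of_nonneg h0])
  refine ⟨C, hC, fun n hn => ?_⟩
  simpa using h n hn

lemma exists_abs_fracF_one_sub_le {s : ℝ} (hs : 0 < s) :
    ∃ C > (0 : ℝ), ∀ n : ℕ, 1 ≤ n →
      |fracF s (n + 1) 1 - fracF s n 1| ≤ C * (n : ℝ) ^ (-(2 * s + 1)) := by
  obtain ⟨C, hC, h⟩ := exists_abs_fracF_one_le hs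
  refine ⟨2 * s * C, by positivity, fun n hn => ?_⟩
  have hn0 : (0 : ℝ) < n := by exact_mod_cast hn
  have hp : (0 : ℝ) < n + 1 + s := by positivity
  have e : fracF s (n + 1) 1 - fracF s n 1 = -((2 * s / (n + 1 + s)) * fracF s n 1) := by
    apply mul_left_cancel₀ hp.ne'
    rw [mul_sub, fracF_one_succ hs.le]
    field_simp
    ring
  rw [e, abs_neg, abs_mul, abs_of_pos (by positivity)]
  calc 2 * s / (n + 1 + s) * |fracF s n 1| ≤ 2 * s / n * (C * (n : ℝ) ^ (-(2 * s))) := by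
        gcongr
        · linarith
        · exact h n hn
    _ = 2 * s * C * (n : ℝ) ^ (-(2 * s + 1)) := by
        rw [neg_add, Real.rpow_add hn0, Real.rpow_neg_one]; field_simp

/-- Uniform bound for the fractional integrals of order at least one half. -/
lemma exists_abs_fracF_le_of_half_le {s : ℝ} (hs : 1 / 2 ≤ s) :
    ∃ C > (0 : ℝ), ∀ n : ℕ, 1 ≤ n → s ≤ n → ∀ y ∈ Icc (-1 : ℝ) 1,
      |fracF s n y| ≤ C * (n : ℝ) ^ (-(s + 1 / 2)) := by
  have hs0 : 0 < s := by linarith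
  obtain ⟨C, hC, h⟩ := exists_abs_fracF_zero_le hs0.le
  set K := C * (1 + (s + 2) ^ 2 * (s + 1)) with hK
  refine ⟨K, by positivity, fun n hn hsn y hy => ?_⟩
  have hn0 : (0 : ℝ) < n := by exact_mod_cast hn
  have hn1 : (1 : ℝ) ≤ n := by exact_mod_cast hn
  rcases eq_or_lt_of_le hy.1 with rfl | hy1
  · simp [fracF, Real.zero_rpow hs0.ne']; positivity
  have h1 := sonine_le_zero hs hn (by linarith) ⟨hy1, hy.2⟩
  have h2 := sq_fracF_le_sonine hs0.le (n := n) (by linarith) hy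
  set r := (n : ℝ) ^ (-(s + 1 / 2)) with hr
  have hr0 : 0 < r := by positivity
  have hA := h n hn
  have hB : |fracD s n 0| ≤ (s + 2) * n * (C * r) := by
    have e := (fracD_relations hs0.le n (y := 0) (by norm_num)).2
    have e' : fracD s n 0 = -((n + 1 + s) * fracF s (n + 1) 0) := by linarith
    rw [e', abs_neg, abs_mul, abs_of_pos (by positivity)]
    have h3 : (n + 1 + s : ℝ) ≤ (s + 2) * n := by nlinarith
    have h4 : |fracF s (n + 1) 0| ≤ C * r := by
      refine (h (n + 1) (by omega)).trans ?_
      gcongr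
      exact Real.rpow_le_rpow_of_nonpos hn0 (by push_cast; linarith) (by linarith)
    gcongr
  have hM : (n : ℝ) ^ 2 / (s + 1) ≤ (n + s) * (n + 1 - s) := by
    rw [div_le_iff₀ (by linarith)]
    have : (n : ℝ) ≤ (n + 1 - s) * (s + 1) := by nlinarith
    nlinarith
  have hM0 : (0 : ℝ) < (n : ℝ) ^ 2 / (s + 1) := by positivity
  have h3 : sonine s n 0 ≤ C ^ 2 * r ^ 2 * (1 + (s + 2) ^ 2 * (s + 1)) := by
    have hA2 : fracF s n 0 ^ 2 ≤ (C * r) ^ 2 := by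
      rw [← sq_abs]; gcongr
    have hB2 : fracD s n 0 ^ 2 ≤ ((s + 2) * n * (C * r)) ^ 2 := by
      rw [← sq_abs]; gcongr
    have : fracD s n 0 ^ 2 / ((n + s) * (n + 1 - s)) ≤
        ((s + 2) * n * (C * r)) ^ 2 / ((n : ℝ) ^ 2 / (s + 1)) := by gcongr
    have e : ((s + 2) * n * (C * r)) ^ 2 / ((n : ℝ) ^ 2 / (s + 1)) =
      (s + 2) ^ 2 * (s + 1) * (C * r) ^ 2 := by field_simp
    rw [e] at this
    simp only [sonine]
    norm_num
    nlinarith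
  apply abs_le_of_sq_le_sq _ (by positivity)
  refine (h2.trans (h1.trans h3)).trans ?_
  rw [hK]
  have : 1 ≤ 1 + (s + 2) ^ 2 * (s + 1) := by nlinarith [sq_nonneg (s + 2)]
  have h5 : 0 < C ^ 2 * r ^ 2 := by positivity
  nlinarith [mul_le_mul_of_nonneg_left (le_mul_of_one_le_left (by linarith) this) h5.le]

lemma abs_fracD_le {s : ℝ} (hs0 : 0 < s) (hs : s ≤ 1 / 2) (n : ℕ) {y : ℝ}
    (hy : y ∈ Ioc (-1 : ℝ) 0) :
    |fracD s n y| ≤ 2 * (1 + y) ^ (s - 1) + n ^ 2 * (1 + y) ^ s := by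
  have hp : 0 < 1 + y := by linarith [hy.1]
  have hr : 0 < (1 + y) ^ (s - 1) := by positivity
  have hr' : 0 < (1 + y) ^ s := by positivity
  induction n using Nat.twoStepInduction with
  | zero =>
    simp only [fracD, fracE_zero]
    rw [abs_of_pos (by positivity)]
    push_cast
    nlinarith
  | one =>
    have h := (fracD_relations hs0.le 0 hy.1).1
    have h0 := abs_fracF_le hs0 0 (τ := y) ⟨hy.1.le, by linarith [hy.2]⟩
    have hD : fracD s 0 y = (1 + y) ^ (s - 1) * s := by simp [fracD, fracE_zero]
    simp only [Nat.cast_zero, zero_add] at h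
    rw [h, hD]
    refine (abs_add_le _ _).trans ?_
    rw [abs_mul, abs_mul, abs_mul, abs_of_pos hr, abs_of_pos hs0,
      abs_of_nonneg (by linarith : 0 ≤ 1 - s), abs_of_nonpos hy.2]
    have : -y * ((1 + y) ^ (s - 1) * s) ≤ 1 * ((1 + y) ^ (s - 1) * 1) := by
      gcongr
      · linarith [hy.1]
      · linarith
    have h2 : (1 - s) * |fracF s 0 y| ≤ 1 * (1 + y) ^ s := by
      gcongr
      linarith
    push_cast
    nlinarith
  | more n h1 _ =>
    have h := fracD_sub hs0.le n hy.1
    have h0 := abs_fracF_le hs0 (n + 1) (τ := y) ⟨hy.1.le, by linarith [hy.2]⟩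
    have e : fracD s (n + 2) y = fracD s n y + (2 * n + 3) * fracF s (n + 1) y := by linarith
    rw [e]
    refine (abs_add_le _ _).trans ?_
    rw [abs_mul, abs_of_pos (by positivity : (0 : ℝ) < 2 * n + 3)]
    have : (2 * n + 3 : ℝ) * |fracF s (n + 1) y| ≤ (2 * n + 3) * (1 + y) ^ s := by gcongr
    push_cast
    have h3 : 0 ≤ (n : ℝ) * (1 + y) ^ s := by positivity
    nlinarith

/-- Uniform bound for the fractional integrals of order at most one half. -/
lemma exists_abs_fracF_le_of_le_half {s : ℝ} (hs0 : 0 < s) (hs : s ≤ 1 / 2) :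
    ∃ C > (0 : ℝ), ∀ n : ℕ, 1 ≤ n → ∀ y ∈ Icc (-1 : ℝ) 1,
      |fracF s n y| ≤ C * (n : ℝ) ^ (-(2 * s)) := by
  obtain ⟨C, hC, h⟩ := exists_abs_fracF_one_le hs0
  refine ⟨C + 5, by linarith, fun n hn y hy => ?_⟩
  have hn0 : (0 : ℝ) < n := by exact_mod_cast hn
  have hn1 : (1 : ℝ) ≤ n := by exact_mod_cast hn
  set r := (n : ℝ) ^ (-(2 * s)) with hr
  have hr0 : 0 < r := by positivity
  set δ := (n : ℝ) ^ (-2 : ℝ) with hδ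
  have hδ0 : 0 < δ := by positivity
  have hδ1 : δ ≤ 1 := Real.rpow_le_one_of_one_le_of_nonpos hn1 (by norm_num)
  have hδn : δ * n ^ 2 = 1 := by
    rw [hδ, ← Real.rpow_natCast, ← Real.rpow_add hn0]; norm_num
  have hδs : δ ^ s = r := by
    rw [hδ, hr, ← Real.rpow_mul hn0.le]; congr 1; ring
  rcases le_total 0 y with h0 | h0
  · have h1 := sonine_le_of_le_half hs0.le hs hn ⟨h0, hy.2⟩
    have h2 := sq_fracF_le_sonine hs0.le (n := n) (by linarith) hy
    have h3 : sonine s n 1 = fracF s n 1 ^ 2 := by simp [sonine]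
    have h4 : |fracF s n y| ≤ |fracF s n 1| := sq_le_sq.mp (by linarith)
    refine h4.trans ((h n hn).trans ?_)
    gcongr
    linarith
  · rcases le_total y (-1 + δ) with h1 | h1
    · refine (abs_fracF_le hs0 n hy).trans ?_
      calc (1 + y) ^ s ≤ δ ^ s := by
            apply Real.rpow_le_rpow (by linarith [hy.1]) (by linarith) hs0.le
        _ ≤ (C + 5) * r := by rw [hδs]; nlinarith
    · set x := -1 + δ with hx
      have hx1 : -1 < x := by linarith
      have h2 := sonine_le_left_of_le_half hs0.le hs hn hx1 h1 h0
      have h3 := sq_fracF_le_sonine hs0.le (n := n) (by linarith) hy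
      have hF := abs_fracF_le hs0 n (τ := x) ⟨hx1.le, by linarith⟩
      have hD := abs_fracD_le hs0 hs n (y := x) ⟨hx1, by linarith⟩
      have e1 : 1 + x = δ := by ring
      rw [e1, hδs] at hF hD
      have e2 : δ ^ (s - 1) = n ^ 2 * r := by
        rw [Real.rpow_sub_one hδ0.ne', hδs, div_eq_iff hδ0.ne']
        linear_combination -r * hδn
      rw [e2] at hD
      have hD' : |fracD s n x| ≤ 3 * n ^ 2 * r := by linarith
      have hM : (n : ℝ) ^ 2 ≤ (n + s) * (n + 1 - s) := by nlinarith
      have hso : sonine s n x ≤ r ^ 2 + 18 * r ^ 2 := by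
        have a1 : fracF s n x ^ 2 ≤ r ^ 2 := by rw [← sq_abs]; gcongr
        have a2 : fracD s n x ^ 2 ≤ (3 * n ^ 2 * r) ^ 2 := by rw [← sq_abs]; gcongr
        have a3 : 1 - x ^ 2 ≤ 2 * δ := by nlinarith
        have a4 : 0 ≤ 1 - x ^ 2 := by nlinarith
        have a5 : (1 - x ^ 2) * fracD s n x ^ 2 / ((n + s) * (n + 1 - s)) ≤
            (2 * δ) * (3 * n ^ 2 * r) ^ 2 / n ^ 2 := by gcongr
        have a6 : (2 * δ) * (3 * n ^ 2 * r) ^ 2 / n ^ 2 = 18 * r ^ 2 := by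
          rw [div_eq_iff (by positivity)]
          linear_combination 18 * n ^ 2 * r ^ 2 * hδn
        rw [a6] at a5
        exact add_le_add a1 a5
      apply abs_le_of_sq_le_sq _ (by positivity)
      have : 25 * r ^ 2 ≤ ((C + 5) * r) ^ 2 := by
        rw [mul_pow]; gcongr; nlinarith
      nlinarith

lemma legendreP_relations (n : ℕ) (y : ℝ) :
    (legendreP (n + 1)).derivative.eval y =
      y * (legendreP n).derivative.eval y + (n + 1) * (legendreP n).eval y ∧
    y * (legendreP (n + 1)).derivative.eval y - (legendreP n).derivative.eval y =
      (n + 1) * (legendreP (n + 1)).eval y := by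
  have h : (Polynomial.X + Polynomial.C (1 : ℝ)) ≠ 0 := Polynomial.X_add_C_ne_zero 1
  have h1 : (legendreP (n + 1)).derivative =
      Polynomial.X * (legendreP n).derivative + Polynomial.C (n + 1 : ℝ) * legendreP n := by
    apply mul_left_cancel₀ h
    apply Polynomial.funext
    intro z
    have := (fracE_relations le_rfl n z).1
    simp only [fracE] at this
    simp only [legendreP, Polynomial.eval_mul, Polynomial.eval_add,
      Polynomial.eval_X, Polynomial.eval_C]
    linear_combination this
  have h2 : Polynomial.X * (legendreP (n + 1)).derivative - (legendreP n).derivative =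
      Polynomial.C (n + 1 : ℝ) * legendreP (n + 1) := by
    apply mul_left_cancel₀ h
    apply Polynomial.funext
    intro z
    have := (fracE_relations le_rfl n z).2
    simp only [fracE] at this
    simp only [legendreP, Polynomial.eval_mul, Polynomial.eval_add, Polynomial.eval_sub,
      Polynomial.eval_X, Polynomial.eval_C]
    linear_combination this
  constructor
  · have := congrArg (Polynomial.eval y) h1
    simpa using this
  · have := congrArg (Polynomial.eval y) h2
    simpa using this

lemma legendreP_sturm (n : ℕ) :
    ((Polynomial.X ^ 2 - 1) * (legendreP n).derivative).derivative =
      Polynomial.C (n * (n + 1) : ℝ) * legendreP n := by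
  rcases n with _ | n
  · simp
  · have h : (Polynomial.X ^ 2 - 1) * (legendreP (n + 1)).derivative =
        Polynomial.C (n + 1 : ℝ) * (Polynomial.X * legendreP (n + 1) - legendreP n) := by
      apply Polynomial.funext
      intro y
      obtain ⟨h1, h2⟩ := legendreP_relations n y
      simp only [Polynomial.eval_mul, Polynomial.eval_sub, Polynomial.eval_pow,
        Polynomial.eval_X, Polynomial.eval_C, Polynomial.eval_one]
      linear_combination y * h2 - h1
    rw [h]
    apply Polynomial.funext
    intro y
    obtain ⟨-, h2⟩ := legendreP_relations n y
    simp only [Polynomial.derivative_mul, Polynomial.derivative_C, Polynomial.derivative_sub,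
      Polynomial.derivative_X, Polynomial.eval_mul, Polynomial.eval_sub, Polynomial.eval_add,
      Polynomial.eval_X, Polynomial.eval_C, Polynomial.eval_one, Polynomial.eval_zero]
    push_cast
    linear_combination (n + 1 : ℝ) * h2

lemma integral_derivative_eval (P : Polynomial ℝ) (a b : ℝ) :
    ∫ t in a..b, P.derivative.eval t = P.eval b - P.eval a :=
  intervalIntegral.integral_eq_sub_of_hasDerivAt (fun x _ => P.hasDerivAt x)
    (P.derivative.continuous.intervalIntegrable _ _)

lemma intervalIntegrable_poly_mul (P Q : Polynomial ℝ) :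
    IntervalIntegrable (fun t => P.eval t * Q.eval t) volume (-1) 1 :=
  (P.continuous.mul Q.continuous).intervalIntegrable _ _

lemma integral_legendreP_mul {n m : ℕ} (h : n ≠ m) :
    ∫ t in (-1 : ℝ)..1, (legendreP n).eval t * (legendreP m).eval t = 0 := by
  have key := integral_derivative_eval ((Polynomial.X ^ 2 - 1) * (legendreP n).derivative *
    legendreP m - (Polynomial.X ^ 2 - 1) * (legendreP m).derivative * legendreP n) (-1) 1
  rw [Polynomial.derivative_sub,
    Polynomial.derivative_mul (f := (Polynomial.X ^ 2 - 1) * (legendreP n).derivative),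
    Polynomial.derivative_mul (f := (Polynomial.X ^ 2 - 1) * (legendreP m).derivative),
    legendreP_sturm, legendreP_sturm] at key
  have e : ∀ t : ℝ, (Polynomial.C (n * (n + 1) : ℝ) * legendreP n * legendreP m +
      (Polynomial.X ^ 2 - 1) * (legendreP n).derivative * (legendreP m).derivative -
      (Polynomial.C (m * (m + 1) : ℝ) * legendreP m * legendreP n +
      (Polynomial.X ^ 2 - 1) * (legendreP m).derivative * (legendreP n).derivative)).eval t =
      ((n - m) * (n + m + 1) : ℝ) * ((legendreP n).eval t * (legendreP m).eval t) := by
    intro t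
    simp only [Polynomial.eval_mul, Polynomial.eval_sub, Polynomial.eval_add,
      Polynomial.eval_C]
    ring
  simp only [e, intervalIntegral.integral_const_mul] at key
  have h0 : ((n - m) * (n + m + 1) : ℝ) ≠ 0 := by
    apply mul_ne_zero
    · rw [sub_ne_zero]; exact_mod_cast h
    · positivity
  apply (mul_eq_zero.mp _).resolve_left h0
  rw [key]
  simp

lemma integral_legendreP_sq (n : ℕ) :
    ∫ t in (-1 : ℝ)..1, (legendreP n).eval t * (legendreP n).eval t = 2 / (2 * n + 1) := by
  have hi : ∀ P Q : Polynomial ℝ,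
      IntervalIntegrable (fun t => P.eval t * Q.eval t) volume (-1) 1 := fun P Q =>
    (P.continuous.mul Q.continuous).intervalIntegrable _ _
  have hi' : ∀ P Q : Polynomial ℝ,
      IntervalIntegrable (fun t => t * (P.eval t * Q.eval t)) volume (-1) 1 := fun P Q =>
    (continuous_id.mul (P.continuous.mul Q.continuous)).intervalIntegrable _ _
  set I : ℕ → ℕ → ℝ := fun i j =>
    ∫ t in (-1 : ℝ)..1, (legendreP i).eval t * (legendreP j).eval t with hI
  have hx : ∀ i j, (i + 2) * I (i + 2) j = (2 * i + 3) *
      (∫ t in (-1 : ℝ)..1, t * ((legendreP (i + 1)).eval t * (legendreP j).eval t))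
      - (i + 1) * I i j := by
    intro i j
    rw [hI]
    simp only
    rw [← intervalIntegral.integral_const_mul, ← intervalIntegral.integral_const_mul,
      ← intervalIntegral.integral_const_mul, ← intervalIntegral.integral_sub
        ((hi' _ _).const_mul _) ((hi _ _).const_mul _)]
    congr 1; ext t
    linear_combination (legendreP j).eval t * legendreP_rec i t
  have h0 : ∀ i j, i ≠ j → I i j = 0 := fun i j h => integral_legendreP_mul h
  change I n n = _
  induction n using Nat.twoStepInduction with
  | zero => simp [hI]; norm_num
  | one => simp [hI, ← sq, integral_pow]; norm_num
  | more n _ ih =>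
    have h1 := hx n (n + 2)
    have h2 := hx (n + 1) (n + 1)
    rw [h0 n (n + 2) (by omega)] at h1
    rw [h0 (n + 1 + 2) (n + 1) (by omega), ih] at h2
    have e : (∫ t in (-1 : ℝ)..1, t * ((legendreP (n + 1)).eval t * (legendreP (n + 2)).eval t)) =
      ∫ t in (-1 : ℝ)..1, t * ((legendreP (n + 1 + 1)).eval t * (legendreP (n + 1)).eval t) := by
      congr 1; ext t; ring
    rw [e] at h1
    set Z := ∫ t in (-1 : ℝ)..1, t * ((legendreP (n + 1 + 1)).eval t * (legendreP (n + 1)).eval t)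
    push_cast at h2 ⊢
    have hn2 : (n + 2 : ℝ) ≠ 0 := by positivity
    have h3 : (2 * (n + 1) + 1 : ℝ) ≠ 0 := by positivity
    have h4 : (2 * (n + 2) + 1 : ℝ) ≠ 0 := by positivity
    field_simp at h2
    rw [eq_div_iff h4]
    apply mul_left_cancel₀ hn2
    apply mul_left_cancel₀ h3
    linear_combination (2 * (n + 1) + 1) * (2 * (n + 2) + 1) * h1 - (2 * n + 3) * h2

lemma legendreP_degree (n : ℕ) : (legendreP n).natDegree ≤ n ∧ 0 < (legendreP n).coeff n := by
  induction n using Nat.twoStepInduction with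
  | zero => simp
  | one => simp
  | more n h1 h2 =>
    have e : legendreP (n + 2) = Polynomial.C (1 / (n + 2 : ℝ)) *
      (Polynomial.C (2 * n + 3 : ℝ) * Polynomial.X * legendreP (n + 1) -
        Polynomial.C (n + 1 : ℝ) * legendreP n) := by
      simp [legendreP, fracLegendre]
    have hx : (Polynomial.C (2 * n + 3 : ℝ) * Polynomial.X * legendreP (n + 1)).natDegree
        ≤ n + 2 := by
      refine Polynomial.natDegree_mul_le.trans ?_
      have : (Polynomial.C (2 * n + 3 : ℝ) * Polynomial.X).natDegree ≤ 1 :=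
        (Polynomial.natDegree_C_mul_le _ _).trans Polynomial.natDegree_X_le
      have := h2.1
      omega
    constructor
    · rw [e]
      refine (Polynomial.natDegree_C_mul_le _ _).trans ?_
      refine (Polynomial.natDegree_sub_le _ _).trans (max_le hx ?_)
      exact (Polynomial.natDegree_C_mul_le _ _).trans (by have := h1.1; omega)
    · rw [e, Polynomial.coeff_C_mul, Polynomial.coeff_sub, mul_assoc, Polynomial.coeff_C_mul,
        Polynomial.coeff_C_mul, Polynomial.coeff_X_mul,
        Polynomial.coeff_eq_zero_of_natDegree_lt (p := legendreP n) (by have := h1.1; omega)]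
      have := h2.2
      rw [mul_zero, sub_zero]
      positivity

lemma exists_legendreP_expansion (p : ℕ) : ∀ P : Polynomial ℝ, P.natDegree ≤ p →
    ∃ a : ℕ → ℝ, P = ∑ n ∈ Finset.range (p + 1), Polynomial.C (a n) * legendreP n := by
  induction p with
  | zero =>
    intro P hP
    refine ⟨fun _ => P.coeff 0, ?_⟩
    simpa using Polynomial.eq_C_of_natDegree_le_zero hP
  | succ p ih =>
    intro P hP
    obtain ⟨hd, hc⟩ := legendreP_degree (p + 1)
    set r := P.coeff (p + 1) / (legendreP (p + 1)).coeff (p + 1) with hr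
    obtain ⟨a, ha⟩ := ih (P - Polynomial.C r * legendreP (p + 1)) (by
      rw [Polynomial.natDegree_le_iff_coeff_eq_zero]
      intro N hN
      rw [Polynomial.coeff_sub, Polynomial.coeff_C_mul]
      rcases Nat.lt_or_ge (p + 1) N with h | h
      · rw [Polynomial.coeff_eq_zero_of_natDegree_lt (by omega),
          Polynomial.coeff_eq_zero_of_natDegree_lt (p := legendreP (p + 1)) (by omega)]
        simp
      · obtain rfl : N = p + 1 := by omega
        rw [hr]; field_simp; ring)
    refine ⟨fun n => if n = p + 1 then r else a n, ?_⟩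
    rw [Finset.sum_range_succ]
    simp only [if_true]
    rw [Finset.sum_congr rfl (g := fun n => Polynomial.C (a n) * legendreP n), ← ha]
    · ring
    · intro n hn
      rw [Finset.mem_range] at hn
      rw [if_neg (by omega)]

/-- The moment of `f` against the Legendre polynomial of degree `n`. -/
noncomputable def legendreCoeff (f : ℝ → ℝ) (n : ℕ) : ℝ :=
  ∫ t in (-1 : ℝ)..1, f t * (legendreP n).eval t

/-- The `L²(-1, 1)` projection onto the polynomials of degree at most `p`. -/
noncomputable def legendreProj (f : ℝ → ℝ) (p : ℕ) : Polynomial ℝ :=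
  ∑ n ∈ Finset.range (p + 1), Polynomial.C ((2 * n + 1) / 2 * legendreCoeff f n) * legendreP n

lemma intervalIntegrable_mul_poly {f : ℝ → ℝ} (hf : ContinuousOn f (Icc (-1) 1))
    (P : Polynomial ℝ) : IntervalIntegrable (fun t => f t * P.eval t) volume (-1) 1 := by
  apply ContinuousOn.intervalIntegrable
  rw [uIcc_of_le (by norm_num)]
  exact hf.mul P.continuous.continuousOn

lemma eval_sum_C_mul (a : ℕ → ℝ) (N : ℕ) (t : ℝ) :
    (∑ n ∈ Finset.range N, Polynomial.C (a n) * legendreP n).eval t =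
      ∑ n ∈ Finset.range N, a n * (legendreP n).eval t := by
  simp [Polynomial.eval_finsetSum]

lemma integral_expansion_mul (a : ℕ → ℝ) (N m : ℕ) :
    ∫ t in (-1 : ℝ)..1, (∑ n ∈ Finset.range N, Polynomial.C (a n) * legendreP n).eval t *
      (legendreP m).eval t = if m < N then a m * (2 / (2 * m + 1)) else 0 := by
  simp only [eval_sum_C_mul, Finset.sum_mul]
  rw [intervalIntegral.integral_finsetSum]
  · simp only [mul_assoc, intervalIntegral.integral_const_mul]
    split_ifs with h
    · rw [Finset.sum_eq_single m]
      · rw [integral_legendreP_sq]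
      · intro b _ hb
        rw [integral_legendreP_mul hb, mul_zero]
      · intro h'; exact absurd (Finset.mem_range.mpr h) h'
    · apply Finset.sum_eq_zero
      intro i hi
      rw [integral_legendreP_mul, mul_zero]
      rintro rfl
      exact h (Finset.mem_range.mp hi)
  · intro i _
    exact (((legendreP i).continuous.const_mul _).mul
      (legendreP m).continuous).intervalIntegrable _ _

/-- Squared distance of `f` to a Legendre expansion. -/
lemma integral_sub_expansion_sq {f : ℝ → ℝ} (hf : ContinuousOn f (Icc (-1) 1)) (a : ℕ → ℝ)
    (N : ℕ) :
    ∫ t in (-1 : ℝ)..1,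
      (f t - (∑ n ∈ Finset.range N, Polynomial.C (a n) * legendreP n).eval t) ^ 2 =
    (∫ t in (-1 : ℝ)..1, f t ^ 2) - 2 * ∑ n ∈ Finset.range N, a n * legendreCoeff f n +
      ∑ n ∈ Finset.range N, a n ^ 2 * (2 / (2 * n + 1)) := by
  set P : Polynomial ℝ := ∑ n ∈ Finset.range N, Polynomial.C (a n) * legendreP n with hP
  have h1 : ∫ t in (-1 : ℝ)..1, f t * P.eval t =
      ∑ n ∈ Finset.range N, a n * legendreCoeff f n := by
    simp only [hP, eval_sum_C_mul, Finset.mul_sum]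
    rw [intervalIntegral.integral_finsetSum]
    · refine Finset.sum_congr rfl fun n _ => ?_
      rw [legendreCoeff, ← intervalIntegral.integral_const_mul]
      congr 1; ext t; ring
    · intro i _
      have := intervalIntegrable_mul_poly hf (Polynomial.C (a i) * legendreP i)
      simpa using this
  have h2 : ∫ t in (-1 : ℝ)..1, P.eval t * P.eval t =
      ∑ n ∈ Finset.range N, a n ^ 2 * (2 / (2 * n + 1)) := by
    have e : ∀ t, P.eval t * P.eval t =
        ∑ n ∈ Finset.range N, a n * (P.eval t * (legendreP n).eval t) := by
      intro t
      have hPt := eval_sum_C_mul a N t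
      rw [← hP] at hPt
      calc P.eval t * P.eval t
          = (∑ n ∈ Finset.range N, a n * (legendreP n).eval t) * P.eval t := by rw [← hPt]
        _ = _ := by
          rw [Finset.sum_mul]
          exact Finset.sum_congr rfl fun n _ => by ring
    simp only [e]
    rw [intervalIntegral.integral_finsetSum]
    · refine Finset.sum_congr rfl fun n hn => ?_
      rw [intervalIntegral.integral_const_mul, hP, integral_expansion_mul,
        if_pos (Finset.mem_range.mp hn)]
      ring
    · intro i _
      exact ((P.continuous.mul (legendreP i).continuous).const_mul _).intervalIntegrable _ _
  have hf2 : IntervalIntegrable (fun t => f t ^ 2) volume (-1) 1 := by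
    apply ContinuousOn.intervalIntegrable
    rw [uIcc_of_le (by norm_num)]
    exact hf.pow 2
  rw [← h1, ← h2, ← intervalIntegral.integral_const_mul, ← intervalIntegral.integral_sub hf2
    ((intervalIntegrable_mul_poly hf P).const_mul _), ← intervalIntegral.integral_add
    (hf2.sub ((intervalIntegrable_mul_poly hf P).const_mul _))
    (intervalIntegrable_poly_mul P P)]
  congr 1; ext t; ring

lemma integral_sub_legendreProj_sq {f : ℝ → ℝ} (hf : ContinuousOn f (Icc (-1) 1)) (p : ℕ) :
    ∫ t in (-1 : ℝ)..1, (f t - (legendreProj f p).eval t) ^ 2 =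
      (∫ t in (-1 : ℝ)..1, f t ^ 2) -
        ∑ n ∈ Finset.range (p + 1), (2 * n + 1) / 2 * legendreCoeff f n ^ 2 := by
  rw [legendreProj, integral_sub_expansion_sq hf, sub_add, Finset.mul_sum,
    ← Finset.sum_sub_distrib]
  congr 1
  refine Finset.sum_congr rfl fun n _ => ?_
  have : (2 * n + 1 : ℝ) ≠ 0 := by positivity
  field_simp
  ring

lemma exists_parseval_le {f : ℝ → ℝ} (hf : ContinuousOn f (Icc (-1) 1)) (p : ℕ) {ε : ℝ}
    (hε : 0 < ε) : ∃ N, p ≤ N ∧ ∫ t in (-1 : ℝ)..1, f t ^ 2 ≤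
      ε + ∑ n ∈ Finset.range (N + 1), (2 * n + 1) / 2 * legendreCoeff f n ^ 2 := by
  set δ := Real.sqrt (ε / 2) with hδ
  have hδ0 : 0 < δ := Real.sqrt_pos.mpr (by positivity)
  obtain ⟨Q, hQ⟩ := exists_polynomial_near_of_continuousOn (-1) 1 f hf δ hδ0
  refine ⟨max p Q.natDegree, le_max_left _ _, ?_⟩
  obtain ⟨a, ha⟩ := exists_legendreP_expansion (max p Q.natDegree) Q (le_max_right _ _)
  have h1 := integral_sub_expansion_sq hf a (max p Q.natDegree + 1)
  rw [← ha] at h1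
  have h2 : ∫ t in (-1 : ℝ)..1, (f t - Q.eval t) ^ 2 ≤ ε := by
    have : ∫ t in (-1 : ℝ)..1, (f t - Q.eval t) ^ 2 ≤ ∫ t in (-1 : ℝ)..1, δ ^ 2 := by
      apply intervalIntegral.integral_mono_on (by norm_num)
      · apply ContinuousOn.intervalIntegrable
        rw [uIcc_of_le (by norm_num)]
        exact (hf.sub Q.continuous.continuousOn).pow 2
      · simp
      · intro t ht
        have := hQ t ht
        rw [abs_sub_comm] at this
        rw [← sq_abs]
        gcongr
    refine this.trans ?_
    rw [hδ, Real.sq_sqrt (by positivity)]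
    simp
    linarith
  have h3 : 0 ≤ ∑ n ∈ Finset.range (max p Q.natDegree + 1),
      ((2 * n + 1) / 2 * legendreCoeff f n ^ 2 - 2 * (a n * legendreCoeff f n) +
        a n ^ 2 * (2 / (2 * n + 1))) := by
    refine Finset.sum_nonneg fun n _ => ?_
    have hn : (0 : ℝ) < 2 * n + 1 := by positivity
    have : (2 * n + 1) / 2 * legendreCoeff f n ^ 2 - 2 * (a n * legendreCoeff f n) +
        a n ^ 2 * (2 / (2 * n + 1)) =
        (2 * n + 1) / 2 * (legendreCoeff f n - a n * (2 / (2 * n + 1))) ^ 2 := by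
      field_simp; ring
    rw [this]
    positivity
  rw [Finset.sum_add_distrib, Finset.sum_sub_distrib, ← Finset.mul_sum] at h3
  linarith

lemma rpow_step_le {n μ : ℝ} (hn : 1 < n) (hμ : 0 < μ) :
    2 * μ * n ^ (-(2 * μ + 1)) ≤ (n - 1) ^ (-(2 * μ)) - n ^ (-(2 * μ)) := by
  have h0 : 0 < n := by linarith
  have h1 : 0 < 1 - 1 / n := by rw [sub_pos, div_lt_one h0]; exact hn
  have e : (n - 1) = n * (1 - 1 / n) := by field_simp
  have h2 : 1 + 2 * μ / n ≤ (1 - 1 / n) ^ (-(2 * μ)) := by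
    have a1 : 1 - 1 / n ≤ Real.exp (-(1 / n)) := by
      have := Real.add_one_le_exp (-(1 / n)); linarith
    have a2 : (Real.exp (-(1 / n))) ^ (-(2 * μ)) ≤ (1 - 1 / n) ^ (-(2 * μ)) :=
      Real.rpow_le_rpow_of_nonpos h1 a1 (by linarith)
    have a3 := Real.add_one_le_exp (2 * μ / n)
    rw [← Real.exp_mul] at a2
    have a4 : -(1 / n) * -(2 * μ) = 2 * μ / n := by ring
    rw [a4] at a2
    linarith
  rw [e, Real.mul_rpow h0.le h1.le, neg_add, Real.rpow_add h0, Real.rpow_neg_one]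
  have h3 : 0 < n ^ (-(2 * μ)) := by positivity
  have h4 := mul_le_mul_of_nonneg_left h2 h3.le
  have e2 : 2 * μ * (n ^ (-(2 * μ)) * n⁻¹) = n ^ (-(2 * μ)) * (1 + 2 * μ / n) - n ^ (-(2 * μ)) := by
    field_simp; ring
  rw [e2]
  linarith

lemma sum_rpow_tail_le {p N : ℕ} (hp : 1 ≤ p) (hN : p ≤ N) {μ : ℝ} (hμ : 0 < μ) :
    ∑ n ∈ Finset.Ico (p + 1) (N + 1), (n : ℝ) ^ (-(2 * μ + 1)) ≤
      ((p : ℝ) ^ (-(2 * μ)) - (N : ℝ) ^ (-(2 * μ))) / (2 * μ) := by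
  induction N, hN using Nat.le_induction with
  | base => simp
  | succ N hN ih =>
    rw [Finset.sum_Ico_succ_top (by omega)]
    have hN0 : (1 : ℝ) < (N + 1 : ℕ) := by push_cast; have : (1 : ℝ) ≤ N := by
                                            exact_mod_cast hp.trans hN
                                           linarith
    have := rpow_step_le hN0 hμ
    rw [le_div_iff₀ (by positivity)] at ih ⊢
    rw [show ((N + 1 : ℕ) : ℝ) - 1 = N by push_cast; ring] at this
    linarith

/-- The error of the `L²` projection, from the decay of the Legendre coefficients. -/
lemma integral_sub_legendreProj_sq_le {f : ℝ → ℝ} (hf : ContinuousOn f (Icc (-1) 1)) {p : ℕ}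
    (hp : 1 ≤ p) {μ K : ℝ} (hμ : 0 < μ)
    (h : ∀ n, p < n → |legendreCoeff f n| ≤ K * (n : ℝ) ^ (-(μ + 1))) :
    ∫ t in (-1 : ℝ)..1, (f t - (legendreProj f p).eval t) ^ 2 ≤
      K ^ 2 * (p : ℝ) ^ (-(2 * μ)) / μ := by
  apply le_of_forall_pos_le_add
  intro ε hε
  obtain ⟨N, hN, hle⟩ := exists_parseval_le hf p hε
  rw [integral_sub_legendreProj_sq hf]
  rw [← Finset.sum_range_add_sum_Ico _ (show p + 1 ≤ N + 1 by omega)] at hle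
  have h1 : ∑ n ∈ Finset.Ico (p + 1) (N + 1), (2 * n + 1) / 2 * legendreCoeff f n ^ 2 ≤
      ∑ n ∈ Finset.Ico (p + 1) (N + 1), 2 * K ^ 2 * (n : ℝ) ^ (-(2 * μ + 1)) := by
    refine Finset.sum_le_sum fun n hn => ?_
    rw [Finset.mem_Ico] at hn
    have hn1 : (1 : ℝ) ≤ n := by exact_mod_cast (by omega : 1 ≤ n)
    have hn0 : (0 : ℝ) < n := by linarith
    have h2 : legendreCoeff f n ^ 2 ≤ (K * (n : ℝ) ^ (-(μ + 1))) ^ 2 := by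
      rw [← sq_abs]; gcongr; exact h n (by omega)
    have h3 : ((n : ℝ) ^ (-(μ + 1))) ^ 2 = (n : ℝ) ^ (-(2 * μ + 1)) * (n : ℝ)⁻¹ := by
      rw [← Real.rpow_natCast, ← Real.rpow_mul hn0.le, ← Real.rpow_neg_one,
        ← Real.rpow_add hn0]
      congr 1; push_cast; ring
    calc (2 * n + 1) / 2 * legendreCoeff f n ^ 2 ≤
          (2 * n) * (K * (n : ℝ) ^ (-(μ + 1))) ^ 2 := by
          gcongr; linarith
      _ = 2 * K ^ 2 * (n : ℝ) ^ (-(2 * μ + 1)) := by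
          rw [mul_pow, h3]; field_simp
  rw [← Finset.mul_sum] at h1
  have h2 := sum_rpow_tail_le hp hN hμ
  have h3 : 0 ≤ (N : ℝ) ^ (-(2 * μ)) := by positivity
  have h4 : 2 * K ^ 2 * ∑ n ∈ Finset.Ico (p + 1) (N + 1), (n : ℝ) ^ (-(2 * μ + 1)) ≤
      K ^ 2 * (p : ℝ) ^ (-(2 * μ)) / μ := by
    calc _ ≤ 2 * K ^ 2 * ((p : ℝ) ^ (-(2 * μ)) / (2 * μ)) := by
          gcongr
          refine h2.trans ?_
          gcongr
          linarith
      _ = _ := by field_simp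
  linarith

lemma sum_legendreP_eq (p : ℕ) (t : ℝ) :
    ∑ n ∈ Finset.range (p + 1), (2 * n + 1 : ℝ) / 2 * (legendreP n).eval t =
      ((legendreP p).derivative.eval t + (legendreP (p + 1)).derivative.eval t) / 2 := by
  induction p with
  | zero => simp
  | succ p ih =>
    rw [Finset.sum_range_succ, ih]
    have := congrArg (Polynomial.eval t) (legendreP_deriv_sub p)
    simp only [Polynomial.eval_sub, Polynomial.eval_mul, Polynomial.eval_C] at this
    push_cast
    linear_combination -this / 2

lemma sum_neg_one_pow_legendreP_eq (p : ℕ) (t : ℝ) :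
    ∑ n ∈ Finset.range (p + 1), (2 * n + 1 : ℝ) / 2 * ((-1) ^ n * (legendreP n).eval t) =
      (-1) ^ p * ((legendreP (p + 1)).derivative.eval t - (legendreP p).derivative.eval t) / 2 := by
  induction p with
  | zero => simp
  | succ p ih =>
    rw [Finset.sum_range_succ, ih]
    have := congrArg (Polynomial.eval t) (legendreP_deriv_sub p)
    simp only [Polynomial.eval_sub, Polynomial.eval_mul, Polynomial.eval_C] at this
    push_cast
    linear_combination (-1 : ℝ) ^ p * this / 2

lemma integral_sum_legendreP {f : ℝ → ℝ} (hf : ContinuousOn f (Icc (-1) 1)) (c : ℕ → ℝ) (p : ℕ) :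
    ∫ t in (-1 : ℝ)..1, f t *
      ∑ n ∈ Finset.range (p + 1), (2 * n + 1 : ℝ) / 2 * (c n * (legendreP n).eval t) =
    ∑ n ∈ Finset.range (p + 1), (2 * n + 1 : ℝ) / 2 * (c n * legendreCoeff f n) := by
  simp only [Finset.mul_sum]
  rw [intervalIntegral.integral_finsetSum]
  · refine Finset.sum_congr rfl fun n _ => ?_
    rw [legendreCoeff, ← mul_assoc, ← intervalIntegral.integral_const_mul]
    congr 1; ext t; ring
  · intro i _
    have := intervalIntegrable_mul_poly hf
      (Polynomial.C ((2 * i + 1 : ℝ) / 2 * c i) * legendreP i)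
    simpa [mul_assoc] using this

/-- The value of the projection at the right endpoint. -/
lemma legendreProj_eval_one {f : ℝ → ℝ} (hf : ContinuousOn f (Icc (-1) 1)) (p : ℕ) :
    (legendreProj f p).eval 1 =
      1 / 2 * ∫ t in (-1 : ℝ)..1, f t * (legendreP p + legendreP (p + 1)).derivative.eval t := by
  have h := integral_sum_legendreP hf (fun _ => 1) p
  simp only [one_mul, sum_legendreP_eq] at h
  rw [legendreProj, eval_sum_C_mul]
  simp only [legendreP_eval_one, mul_one]
  rw [← h, ← intervalIntegral.integral_const_mul]
  congr 1; ext t; simp; ring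

/-- The value of the projection at the left endpoint. -/
lemma legendreProj_eval_neg_one {f : ℝ → ℝ} (hf : ContinuousOn f (Icc (-1) 1)) (p : ℕ) :
    (legendreProj f p).eval (-1) = (-1) ^ p / 2 *
      ∫ t in (-1 : ℝ)..1, f t * (legendreP (p + 1) - legendreP p).derivative.eval t := by
  have h := integral_sum_legendreP hf (fun n => (-1) ^ n) p
  simp only [sum_neg_one_pow_legendreP_eq] at h
  rw [legendreProj, eval_sum_C_mul]
  simp only [legendreP_eval_neg_one]
  have e : ∑ n ∈ Finset.range (p + 1), (2 * n + 1 : ℝ) / 2 * legendreCoeff f n * (-1) ^ n =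
    ∑ n ∈ Finset.range (p + 1), (2 * n + 1 : ℝ) / 2 * ((-1) ^ n * legendreCoeff f n) :=
    Finset.sum_congr rfl fun n _ => by ring
  rw [e, ← h, ← intervalIntegral.integral_const_mul]
  congr 1; ext t; simp; ring

/-- A polynomial whose error is orthogonal to lower degrees differs from the `L²` projection by
a multiple of the last Legendre polynomial. -/
lemma exists_eq_legendreProj_add {f : ℝ → ℝ} (hf : ContinuousOn f (Icc (-1) 1)) {p : ℕ}
    {P : Polynomial ℝ} (hP : P.natDegree ≤ p)
    (h : ∀ n < p, ∫ t in (-1 : ℝ)..1, (P.eval t - f t) * (legendreP n).eval t = 0) :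
    ∃ κ : ℝ, P = legendreProj f p + Polynomial.C κ * legendreP p := by
  obtain ⟨a, ha⟩ := exists_legendreP_expansion p P hP
  refine ⟨a p - (2 * p + 1) / 2 * legendreCoeff f p, ?_⟩
  have hn : ∀ n < p, a n = (2 * n + 1) / 2 * legendreCoeff f n := by
    intro n hn
    have h1 := h n hn
    have h2 := integral_expansion_mul a (p + 1) n
    rw [← ha, if_pos (by omega)] at h2
    simp only [sub_mul] at h1
    rw [intervalIntegral.integral_sub
      (intervalIntegrable_poly_mul P (legendreP n))
      (intervalIntegrable_mul_poly hf _), h2] at h1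
    change _ - legendreCoeff f n = 0 at h1
    have h3 : (2 * n + 1 : ℝ) ≠ 0 := by positivity
    rw [← sub_eq_zero.mp h1]
    field_simp
  conv_lhs => rw [ha]
  rw [legendreProj, Finset.sum_range_succ, Finset.sum_range_succ, add_assoc, ← add_mul,
    ← Polynomial.C_add]
  congr 1
  · refine Finset.sum_congr rfl fun n h' => ?_
    rw [hn n (Finset.mem_range.mp h')]
  · congr 2; ring

/-- `f` is a combination of the singular functions `(1 - t)^(α + i)` and a superposition of
truncated powers `(τ - t)_+^β`. -/
structure SingularRep (m : ℕ) (α β : ℝ) (f : ℝ → ℝ) (d : ℕ → ℝ) (ψ : ℝ → ℝ) : Prop where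
  cont : ContinuousOn f (Icc (-1) 1)
  int : IntervalIntegrable ψ volume (-1) 1
  eq : ∀ t ∈ Icc (-1 : ℝ) 1, f t = ∑ i ∈ Finset.range m, d i * (1 - t) ^ (α + i) +
    ∫ τ in (-1 : ℝ)..1, ψ τ * (max (τ - t) 0) ^ β

/-- The total mass of the coefficients of a singular representation. -/
noncomputable def singularMass (m : ℕ) (d : ℕ → ℝ) (ψ : ℝ → ℝ) : ℝ :=
  ∑ i ∈ Finset.range m, |d i| + ∫ τ in (-1 : ℝ)..1, |ψ τ|

lemma singularMass_nonneg (m : ℕ) (d : ℕ → ℝ) (ψ : ℝ → ℝ) : 0 ≤ singularMass m d ψ :=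
  add_nonneg (Finset.sum_nonneg fun _ _ => abs_nonneg _)
    (intervalIntegral.integral_nonneg (by norm_num) fun _ _ => abs_nonneg _)

lemma abs_sum_add_integral_le {m : ℕ} {d A : ℕ → ℝ} {ψ G : ℝ → ℝ} {B : ℝ}
    (hψ : IntervalIntegrable ψ volume (-1) 1) (hA : ∀ i < m, |A i| ≤ B)
    (hG : ∀ τ ∈ Icc (-1 : ℝ) 1, |G τ| ≤ B) :
    |∑ i ∈ Finset.range m, d i * A i + ∫ τ in (-1 : ℝ)..1, ψ τ * G τ| ≤
      B * singularMass m d ψ := by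
  rw [singularMass, mul_add]
  refine (abs_add_le _ _).trans (add_le_add ?_ ?_)
  · refine (Finset.abs_sum_le_sum_abs _ _).trans ?_
    rw [Finset.mul_sum]
    refine Finset.sum_le_sum fun i hi => ?_
    rw [abs_mul, mul_comm]
    exact mul_le_mul_of_nonneg_right (hA i (Finset.mem_range.mp hi)) (abs_nonneg _)
  · rw [← intervalIntegral.integral_const_mul, ← Real.norm_eq_abs]
    refine intervalIntegral.norm_integral_le_of_norm_le (by norm_num)
      (Eventually.of_forall fun τ hτ => ?_) (hψ.abs.const_mul B)
    rw [Real.norm_eq_abs, abs_mul, mul_comm]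
    exact mul_le_mul_of_nonneg_right (hG τ ⟨hτ.1.le, hτ.2⟩) (abs_nonneg _)

lemma integral_max_sub_rpow_mul {β : ℝ} (hβ : 0 < β) {τ : ℝ} (hτ : τ ∈ Icc (-1 : ℝ) 1)
    (v : Polynomial ℝ) :
    ∫ t in (-1 : ℝ)..1, (max (τ - t) 0) ^ β * v.eval t =
      ∫ t in (-1 : ℝ)..τ, (τ - t) ^ β * v.eval t := by
  have hc : Continuous fun t : ℝ => (max (τ - t) 0) ^ β * v.eval t :=
    (((continuous_const.sub continuous_id).max continuous_const).rpow_const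
      fun _ => Or.inr hβ.le).mul v.continuous
  rw [← intervalIntegral.integral_add_adjacent_intervals (b := τ)
    (hc.intervalIntegrable _ _) (hc.intervalIntegrable _ _)]
  have h2 : ∫ t in τ..1, (max (τ - t) 0) ^ β * v.eval t = 0 := by
    rw [intervalIntegral.integral_congr (g := fun _ => 0)]
    · simp
    · intro t ht
      rw [uIcc_of_le hτ.2] at ht
      simp only
      rw [max_eq_right (by linarith [ht.1]), Real.zero_rpow hβ.ne', zero_mul]
  rw [h2, add_zero]
  refine intervalIntegral.integral_congr fun t ht => ?_
  rw [uIcc_of_le hτ.1] at ht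
  rw [max_eq_left (by linarith [ht.2])]

lemma SingularRep.integral_mul {m : ℕ} {α β : ℝ} {f : ℝ → ℝ} {d : ℕ → ℝ} {ψ : ℝ → ℝ}
    (h : SingularRep m α β f d ψ) (hα : 0 < α) (hβ : 0 < β) (v : Polynomial ℝ) :
    ∫ t in (-1 : ℝ)..1, f t * v.eval t =
      ∑ i ∈ Finset.range m, d i * (∫ t in (-1 : ℝ)..1, (1 - t) ^ (α + i) * v.eval t) +
      ∫ τ in (-1 : ℝ)..1, ψ τ * (∫ t in (-1 : ℝ)..τ, (τ - t) ^ β * v.eval t) := by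
  have hle : (-1 : ℝ) ≤ 1 := by norm_num
  have hi : ∀ i ∈ Finset.range m, IntervalIntegrable
      (fun t : ℝ => d i * ((1 - t) ^ (α + i) * v.eval t)) volume (-1) 1 := fun i _ =>
    (intervalIntegrable_sub_rpow_mul (by have : (0:ℝ) ≤ i := i.cast_nonneg
                                         linarith) (-1) 1 1 v).const_mul _
  set μ : Measure ℝ := volume.restrict (Ioc (-1 : ℝ) 1) with hμ
  have hψ : Integrable ψ μ := (intervalIntegrable_iff_integrableOn_Ioc_of_le hle).mp h.int
  have hv : Integrable (fun t => v.eval t) μ :=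
    (intervalIntegrable_iff_integrableOn_Ioc_of_le hle).mp (v.continuous.intervalIntegrable _ _)
  have hK : Integrable (fun z : ℝ × ℝ => (max (z.2 - z.1) 0) ^ β * (v.eval z.1 * ψ z.2))
      (μ.prod μ) := by
    refine (hv.mul_prod hψ).bdd_mul (c := (2 : ℝ) ^ β) ?_ ?_
    · have : Continuous fun z : ℝ × ℝ => (max (z.2 - z.1) 0) ^ β :=
        ((continuous_snd.sub continuous_fst).max continuous_const).rpow_const
          fun _ => Or.inr hβ.le
      exact this.aestronglyMeasurable
    · rw [hμ, Measure.prod_restrict]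
      refine (ae_restrict_iff' (measurableSet_Ioc.prod measurableSet_Ioc)).mpr
        (Eventually.of_forall fun z hz => ?_)
      rw [Real.norm_eq_abs, abs_of_nonneg (Real.rpow_nonneg (le_max_right _ _) _)]
      exact Real.rpow_le_rpow (le_max_right _ _)
        (max_le (by linarith [hz.1.1, hz.2.2]) (by norm_num)) hβ.le
  have hswap : ∫ t in (-1 : ℝ)..1, (∫ τ in (-1 : ℝ)..1, ψ τ * (max (τ - t) 0) ^ β) * v.eval t =
      ∫ τ in (-1 : ℝ)..1, ψ τ * (∫ t in (-1 : ℝ)..τ, (τ - t) ^ β * v.eval t) := by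
    calc _ = ∫ t in (-1 : ℝ)..1, ∫ τ in (-1 : ℝ)..1,
          (max (τ - t) 0) ^ β * (v.eval t * ψ τ) := by
          congr 1; ext t
          rw [← intervalIntegral.integral_mul_const]
          congr 1; ext τ; ring
      _ = ∫ τ in (-1 : ℝ)..1, ∫ t in (-1 : ℝ)..1,
          (max (τ - t) 0) ^ β * (v.eval t * ψ τ) := by
          simp only [intervalIntegral.integral_of_le hle]
          exact integral_integral_swap hK
      _ = _ := by
          refine intervalIntegral.integral_congr fun τ hτ => ?_
          rw [uIcc_of_le hle] at hτ
          rw [← integral_max_sub_rpow_mul hβ hτ, ← intervalIntegral.integral_const_mul]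
          congr 1; ext t; ring
  have hint : IntervalIntegrable
      (fun t => (∫ τ in (-1 : ℝ)..1, ψ τ * (max (τ - t) 0) ^ β) * v.eval t) volume (-1) 1 := by
    rw [intervalIntegrable_iff_integrableOn_Ioc_of_le hle]
    refine hK.integral_prod_left.congr (Eventually.of_forall fun t => ?_)
    simp only [intervalIntegral.integral_of_le hle]
    rw [← integral_mul_const]
    congr 1; ext τ; ring
  have hs : IntervalIntegrable (fun t : ℝ => ∑ i ∈ Finset.range m,
      d i * ((1 - t) ^ (α + i) * v.eval t)) volume (-1) 1 := by
    have := IntervalIntegrable.sum _ hi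
    rwa [Finset.sum_fn] at this
  rw [← hswap, ← Finset.sum_congr rfl fun i _ => intervalIntegral.integral_const_mul _ _,
    ← intervalIntegral.integral_finsetSum hi, ← intervalIntegral.integral_add hs hint]
  refine intervalIntegral.integral_congr fun t ht => ?_
  rw [uIcc_of_le hle] at ht
  rw [h.eq t ht, add_mul, Finset.sum_mul]
  congr 1
  · simp only [mul_assoc]

lemma integral_sub_rpow_mul_derivative_legendreP {γ : ℝ} (hγ : 0 < γ) (n : ℕ) {τ : ℝ}
    (hτ : -1 ≤ τ) :
    ∫ t in (-1 : ℝ)..τ, (τ - t) ^ γ * (legendreP n).derivative.eval t =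
      fracF γ n τ - (1 + τ) ^ γ * (-1) ^ n := by
  rw [integral_sub_rpow_mul_derivative hγ hτ, integral_sub_rpow_mul_legendreP hγ n hτ,
    legendreP_eval_neg_one, mul_div_cancel₀ _ hγ.ne', sub_neg_eq_add, add_comm τ 1]

lemma integral_sub_rpow_mul_derivative_add {γ : ℝ} (hγ : 0 < γ) (n : ℕ) {τ : ℝ}
    (hτ : -1 ≤ τ) :
    ∫ t in (-1 : ℝ)..τ, (τ - t) ^ γ * (legendreP n + legendreP (n + 1)).derivative.eval t =
      fracF γ n τ + fracF γ (n + 1) τ := by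
  have hi := fun Q => intervalIntegrable_sub_rpow_mul (s := γ) (by linarith) (-1) τ τ Q
  simp only [Polynomial.derivative_add, Polynomial.eval_add, mul_add]
  rw [intervalIntegral.integral_add (hi _) (hi _),
    integral_sub_rpow_mul_derivative_legendreP hγ _ hτ,
    integral_sub_rpow_mul_derivative_legendreP hγ _ hτ]
  ring

lemma integral_sub_rpow_mul_derivative_sub {γ : ℝ} (hγ : 0 < γ) (n : ℕ) {τ : ℝ}
    (hτ : -1 ≤ τ) :
    ∫ t in (-1 : ℝ)..τ, (τ - t) ^ γ * (legendreP (n + 1) - legendreP n).derivative.eval t =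
      fracF γ (n + 1) τ - fracF γ n τ + 2 * (-1) ^ n * (1 + τ) ^ γ := by
  have hi := fun Q => intervalIntegrable_sub_rpow_mul (s := γ) (by linarith) (-1) τ τ Q
  simp only [Polynomial.derivative_sub, Polynomial.eval_sub, mul_sub]
  rw [intervalIntegral.integral_sub (hi _) (hi _),
    integral_sub_rpow_mul_derivative_legendreP hγ _ hτ,
    integral_sub_rpow_mul_derivative_legendreP hγ _ hτ]
  ring

section Errors

variable {m : ℕ} {α β : ℝ} {f : ℝ → ℝ} {d : ℕ → ℝ} {ψ : ℝ → ℝ}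

lemma SingularRep.legendreCoeff_eq (h : SingularRep m α β f d ψ) (hα : 0 < α) (hβ : 0 < β)
    (n : ℕ) :
    legendreCoeff f n = ∑ i ∈ Finset.range m, d i * (fracF (α + i + 1) n 1 / (α + i + 1)) +
      ∫ τ in (-1 : ℝ)..1, ψ τ * (fracF (β + 1) n τ / (β + 1)) := by
  rw [legendreCoeff, h.integral_mul hα hβ]
  congr 1
  · refine Finset.sum_congr rfl fun i _ => ?_
    rw [← integral_sub_rpow_mul_legendreP (by positivity) n (by norm_num), add_sub_cancel_right]
  · refine intervalIntegral.integral_congr fun τ hτ => ?_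
    rw [uIcc_of_le (by norm_num)] at hτ
    rw [← integral_sub_rpow_mul_legendreP (by positivity) n hτ.1, add_sub_cancel_right]

lemma SingularRep.eval_one (h : SingularRep m α β f d ψ) (hα : 0 < α) (hβ : 0 < β) :
    f 1 = 0 := by
  rw [h.eq 1 (by norm_num), Finset.sum_eq_zero, zero_add, intervalIntegral.integral_congr
    (g := fun _ => 0)]
  · simp
  · intro τ hτ
    rw [uIcc_of_le (by norm_num)] at hτ
    simp only
    rw [max_eq_right (by linarith [hτ.2]), Real.zero_rpow hβ.ne', mul_zero]
  · intro i _
    rw [sub_self, Real.zero_rpow (by positivity), mul_zero]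

lemma SingularRep.eval_one_sub (h : SingularRep m α β f d ψ) (hα : 0 < α) (hβ : 0 < β)
    (p : ℕ) :
    f 1 - (legendreProj f p).eval 1 = -(1 / 2) *
      (∑ i ∈ Finset.range m, d i * (fracF (α + i) p 1 + fracF (α + i) (p + 1) 1) +
      ∫ τ in (-1 : ℝ)..1, ψ τ * (fracF β p τ + fracF β (p + 1) τ)) := by
  rw [h.eval_one hα hβ, legendreProj_eval_one h.cont, h.integral_mul hα hβ, zero_sub,
    ← neg_mul]
  congr 2
  · refine Finset.sum_congr rfl fun i _ => ?_
    rw [integral_sub_rpow_mul_derivative_add (by positivity) p (by norm_num)]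
  · refine intervalIntegral.integral_congr fun τ hτ => ?_
    rw [uIcc_of_le (by norm_num)] at hτ
    rw [integral_sub_rpow_mul_derivative_add hβ p hτ.1]

lemma continuous_fracF {s : ℝ} (hs : 0 < s) (n : ℕ) : Continuous (fracF s n) := by
  unfold fracF
  exact ((continuous_const.add continuous_id).rpow_const fun _ => Or.inr hs.le).mul
    (Polynomial.continuous _)

lemma SingularRep.eval_neg_one_sub (h : SingularRep m α β f d ψ) (hα : 0 < α) (hβ : 0 < β)
    (p : ℕ) :
    f (-1) - (legendreProj f p).eval (-1) = -((-1) ^ p / 2) *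
      (∑ i ∈ Finset.range m, d i * (fracF (α + i) (p + 1) 1 - fracF (α + i) p 1) +
      ∫ τ in (-1 : ℝ)..1, ψ τ * (fracF β (p + 1) τ - fracF β p τ)) := by
  have hpow : ((-1 : ℝ) ^ p) * (-1) ^ p = 1 := by rw [← mul_pow]; norm_num
  rw [h.eq (-1) (by norm_num), legendreProj_eval_neg_one h.cont, h.integral_mul hα hβ]
  have h1 : ∀ i ∈ Finset.range m, d i * (∫ t in (-1 : ℝ)..1, (1 - t) ^ (α + i) *
      (legendreP (p + 1) - legendreP p).derivative.eval t) =
      d i * (fracF (α + i) (p + 1) 1 - fracF (α + i) p 1) +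
        2 * (-1) ^ p * (d i * (1 - (-1)) ^ (α + i)) := by
    intro i _
    rw [integral_sub_rpow_mul_derivative_sub (by positivity) p (by norm_num), sub_neg_eq_add]
    ring
  have h2 : ∫ τ in (-1 : ℝ)..1, ψ τ * (∫ t in (-1 : ℝ)..τ, (τ - t) ^ β *
      (legendreP (p + 1) - legendreP p).derivative.eval t) =
      (∫ τ in (-1 : ℝ)..1, ψ τ * (fracF β (p + 1) τ - fracF β p τ)) +
      2 * (-1) ^ p * ∫ τ in (-1 : ℝ)..1, ψ τ * (max (τ - (-1)) 0) ^ β := by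
    have hc : ∀ n, Continuous (fracF β n) := continuous_fracF hβ
    have hm : Continuous fun τ : ℝ => (max (τ - (-1)) 0) ^ β :=
      ((continuous_id.sub continuous_const).max continuous_const).rpow_const
        fun _ => Or.inr hβ.le
    have hd : IntervalIntegrable (fun τ => ψ τ * (fracF β (p + 1) τ - fracF β p τ))
        volume (-1) 1 :=
      h.int.mul_continuousOn ((hc (p + 1)).sub (hc p)).continuousOn
    rw [← intervalIntegral.integral_const_mul, ← intervalIntegral.integral_add hd
      ((h.int.mul_continuousOn hm.continuousOn).const_mul _)]
    refine intervalIntegral.integral_congr fun τ hτ => ?_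
    rw [uIcc_of_le (by norm_num)] at hτ
    rw [integral_sub_rpow_mul_derivative_sub hβ p hτ.1, max_eq_left (by linarith [hτ.1]),
      sub_neg_eq_add, add_comm τ 1]
    ring
  rw [Finset.sum_congr rfl h1, h2, Finset.sum_add_distrib, ← Finset.mul_sum]
  linear_combination (-(∑ i ∈ Finset.range m, d i * (1 - (-1)) ^ (α + i)) -
    ∫ τ in (-1 : ℝ)..1, ψ τ * (max (τ - (-1)) 0) ^ β) * hpow

end Errors

lemma rpow_neg_le_rpow_neg {n : ℕ} (hn : 1 ≤ n) {e e' : ℝ} (h : e ≤ e') :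
    (n : ℝ) ^ (-e') ≤ (n : ℝ) ^ (-e) :=
  Real.rpow_le_rpow_of_exponent_le (by exact_mod_cast hn) (by linarith)

lemma succ_rpow_neg_le {n : ℕ} (hn : 1 ≤ n) {e : ℝ} (he : 0 ≤ e) :
    ((n + 1 : ℕ) : ℝ) ^ (-e) ≤ (n : ℝ) ^ (-e) := by
  have hn0 : (0 : ℝ) < n := by exact_mod_cast hn
  exact Real.rpow_le_rpow_of_nonpos hn0 (by push_cast; linarith) (by linarith)

lemma exists_uniform_decay {a : ℕ → ℕ → ℝ} {e : ℝ}
    (h : ∀ i, ∃ C > (0 : ℝ), ∀ n : ℕ, 1 ≤ n → |a i n| ≤ C * (n : ℝ) ^ (-e)) (m : ℕ) :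
    ∃ C > (0 : ℝ), ∀ i < m, ∀ n : ℕ, 1 ≤ n → |a i n| ≤ C * (n : ℝ) ^ (-e) := by
  choose C hC h using h
  refine ⟨1 + ∑ i ∈ Finset.range m, C i,
    add_pos_of_pos_of_nonneg one_pos (Finset.sum_nonneg fun i _ => (hC i).le),
    fun i hi n hn => (h i n hn).trans ?_⟩
  have := Finset.single_le_sum (f := C) (fun i _ => (hC i).le) (Finset.mem_range.mpr hi)
  exact mul_le_mul_of_nonneg_right (by linarith) (Real.rpow_nonneg n.cast_nonneg _)

lemma exists_abs_fracF_add_one_le {s : ℝ} (hs : 0 < s) (m : ℕ) :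
    ∃ C > (0 : ℝ), ∀ i < m, ∀ n : ℕ, 1 ≤ n →
      |fracF (s + i) n 1| ≤ C * (n : ℝ) ^ (-(2 * s)) := by
  refine exists_uniform_decay (a := fun i n => fracF (s + i) n 1) (fun i => ?_) m
  obtain ⟨C, hC, h⟩ := exists_abs_fracF_one_le (s := s + i) (by positivity)
  refine ⟨C, hC, fun n hn => (h n hn).trans ?_⟩
  have : (0 : ℝ) ≤ i := i.cast_nonneg
  exact mul_le_mul_of_nonneg_left (rpow_neg_le_rpow_neg hn (by linarith)) hC.le

lemma exists_abs_fracF_add_one_sub_le {s : ℝ} (hs : 0 < s) (m : ℕ) :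
    ∃ C > (0 : ℝ), ∀ i < m, ∀ n : ℕ, 1 ≤ n →
      |fracF (s + i) (n + 1) 1 - fracF (s + i) n 1| ≤ C * (n : ℝ) ^ (-(2 * s + 1)) := by
  refine exists_uniform_decay
    (a := fun i n => fracF (s + i) (n + 1) 1 - fracF (s + i) n 1) (fun i => ?_) m
  obtain ⟨C, hC, h⟩ := exists_abs_fracF_one_sub_le (s := s + i) (by positivity)
  refine ⟨C, hC, fun n hn => (h n hn).trans ?_⟩
  have : (0 : ℝ) ≤ i := i.cast_nonneg
  exact mul_le_mul_of_nonneg_left (rpow_neg_le_rpow_neg hn (by linarith)) hC.le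

lemma exists_abs_fracF_le {s : ℝ} (hs : 0 < s) :
    ∃ C > (0 : ℝ), ∀ n : ℕ, 1 ≤ n → s ≤ n → ∀ y ∈ Icc (-1 : ℝ) 1,
      |fracF s n y| ≤ C * (n : ℝ) ^ (-(min (2 * s) (s + 1 / 2))) := by
  rcases le_total s (1 / 2) with h | h
  · obtain ⟨C, hC, hb⟩ := exists_abs_fracF_le_of_le_half hs h
    rw [min_eq_left (by linarith)]
    exact ⟨C, hC, fun n hn _ => hb n hn⟩
  · obtain ⟨C, hC, hb⟩ := exists_abs_fracF_le_of_half_le h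
    rw [min_eq_right (by linarith)]
    exact ⟨C, hC, hb⟩

/-- Errors of the `L²` projection of a singular function. -/
lemma exists_legendreProj_bounds (m : ℕ) {α β : ℝ} (hα : 0 < α) (hβ : α ≤ β) :
    ∃ C > (0 : ℝ), ∀ p : ℕ, 1 ≤ p → β ≤ p → ∀ (f : ℝ → ℝ) (d : ℕ → ℝ) (ψ : ℝ → ℝ),
      SingularRep m α β f d ψ →
      Real.sqrt (∫ t in (-1 : ℝ)..1, (f t - (legendreProj f p).eval t) ^ 2) ≤
        C * (p : ℝ) ^ (-(min (2 * α + 1) (β + 1 / 2))) * singularMass m d ψ ∧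
      |f 1 - (legendreProj f p).eval 1| ≤
        C * (p : ℝ) ^ (-(min (2 * α) (β + 1 / 2))) * singularMass m d ψ ∧
      |f (-1) - (legendreProj f p).eval (-1)| ≤
        C * (p : ℝ) ^ (-(min (2 * α + 1) (min (2 * β) (β + 1 / 2)))) * singularMass m d ψ := by
  have hβ0 : 0 < β := hα.trans_le hβ
  obtain ⟨C₁, hC₁, h₁⟩ := exists_abs_fracF_add_one_le hα m
  obtain ⟨C₂, hC₂, h₂⟩ := exists_abs_fracF_add_one_sub_le hα m
  obtain ⟨C₃, hC₃, h₃⟩ := exists_abs_fracF_le hβ0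
  obtain ⟨C₄, hC₄, h₄⟩ := exists_abs_fracF_add_one_le (s := α + 1) (by linarith) m
  obtain ⟨C₅, hC₅, h₅⟩ := exists_abs_fracF_le_of_half_le (s := β + 1) (by linarith)
  set μ := min (2 * α + 1) (β + 1 / 2) with hμ
  have hμ0 : 0 < μ := lt_min (by linarith) (by linarith)
  refine ⟨(C₄ + C₅) / Real.sqrt μ + (C₁ + C₃) + (C₂ + 2 * C₃), by positivity,
    fun p hp hβp f d ψ h => ?_⟩
  have hp0 : (0 : ℝ) < p := by exact_mod_cast hp
  set U := singularMass m d ψ with hU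
  have hU0 : 0 ≤ U := singularMass_nonneg m d ψ
  have hs : 0 ≤ (C₄ + C₅) / Real.sqrt μ := by positivity
  have weaken : ∀ {c x e : ℝ}, c ≤ (C₄ + C₅) / Real.sqrt μ + (C₁ + C₃) + (C₂ + 2 * C₃) →
      x ≤ c * (p : ℝ) ^ (-e) * U →
      x ≤ ((C₄ + C₅) / Real.sqrt μ + (C₁ + C₃) + (C₂ + 2 * C₃)) * (p : ℝ) ^ (-e) * U := by
    intro c x e hc hx
    refine hx.trans (mul_le_mul_of_nonneg_right (mul_le_mul_of_nonneg_right hc ?_) hU0)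
    positivity
  have hF3 : ∀ τ ∈ Icc (-1 : ℝ) 1, |fracF β p τ| ≤ C₃ * (p : ℝ) ^ (-(min (2 * β) (β + 1 / 2)))
      ∧ |fracF β (p + 1) τ| ≤ C₃ * (p : ℝ) ^ (-(min (2 * β) (β + 1 / 2))) := by
    intro τ hτ
    refine ⟨h₃ p hp hβp τ hτ, (h₃ (p + 1) (by omega) (by push_cast; linarith) τ hτ).trans ?_⟩
    exact mul_le_mul_of_nonneg_left
      (succ_rpow_neg_le hp (le_min (by linarith) (by linarith))) hC₃.le
  refine ⟨weaken (c := (C₄ + C₅) / Real.sqrt μ) (by linarith) ?_,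
    weaken (c := C₁ + C₃) (by linarith) ?_, weaken (c := C₂ + 2 * C₃) (by linarith) ?_⟩
  · have hc : ∀ n, p < n → |legendreCoeff f n| ≤ (C₄ + C₅) * U * (n : ℝ) ^ (-(μ + 1)) := by
      intro n hn
      have hn1 : 1 ≤ n := by omega
      have hn0 : (0 : ℝ) < n := by exact_mod_cast hn1
      have hpn : (p : ℝ) + 1 ≤ n := by exact_mod_cast hn
      rw [h.legendreCoeff_eq hα hβ0]
      have hpos : 0 ≤ (n : ℝ) ^ (-(μ + 1)) := by positivity
      refine (abs_sum_add_integral_le (B := (C₄ + C₅) * (n : ℝ) ^ (-(μ + 1))) h.int ?_ ?_).trans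
        (le_of_eq (by ring))
      · intro i hi
        have hi0 : (0 : ℝ) ≤ i := i.cast_nonneg
        have h1 := h₄ i hi n hn1
        rw [abs_div, abs_of_pos (show 0 < α + i + 1 by positivity)]
        refine (div_le_self (abs_nonneg _) (by linarith)).trans ?_
        rw [show α + i + 1 = α + 1 + i by ring]
        refine h1.trans (mul_le_mul (by linarith) (rpow_neg_le_rpow_neg hn1 ?_) (by positivity)
          (by positivity))
        linarith [min_le_left (2 * α + 1) (β + 1 / 2)]
      · intro τ hτ
        have h1 := h₅ n hn1 (by linarith) τ hτ
        rw [abs_div, abs_of_pos (show 0 < β + 1 by positivity)]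
        refine (div_le_self (abs_nonneg _) (by linarith)).trans ?_
        refine h1.trans (mul_le_mul (by linarith) (rpow_neg_le_rpow_neg hn1 ?_) (by positivity)
          (by positivity))
        linarith [min_le_right (2 * α + 1) (β + 1 / 2)]
    have := integral_sub_legendreProj_sq_le h.cont hp hμ0 hc
    apply Real.sqrt_le_iff.mpr
    refine ⟨by positivity, this.trans (le_of_eq ?_)⟩
    rw [show (p : ℝ) ^ (-(2 * μ)) = ((p : ℝ) ^ (-μ)) ^ 2 by
      rw [← Real.rpow_natCast, ← Real.rpow_mul hp0.le]; norm_num; ring_nf]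
    simp only [mul_pow, div_pow, Real.sq_sqrt hμ0.le]
    ring
  · rw [h.eval_one_sub hα hβ0, abs_mul]
    have := abs_sum_add_integral_le (m := m) (d := d)
      (A := fun i => fracF (α + i) p 1 + fracF (α + i) (p + 1) 1)
      (G := fun τ => fracF β p τ + fracF β (p + 1) τ)
      (B := 2 * ((C₁ + C₃) * (p : ℝ) ^ (-(min (2 * α) (β + 1 / 2))))) h.int ?_ ?_
    · rw [abs_of_neg (by norm_num : -(1 / 2 : ℝ) < 0)]
      linarith
    · intro i hi
      have h1 := h₁ i hi p hp
      have h2 := (h₁ i hi (p + 1) (by omega)).trans (mul_le_mul_of_nonneg_left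
        (succ_rpow_neg_le hp (by linarith : 0 ≤ 2 * α)) hC₁.le)
      have h3 := rpow_neg_le_rpow_neg hp (min_le_left (2 * α) (β + 1 / 2))
      have h4 : C₁ * (p : ℝ) ^ (-(2 * α)) ≤ (C₁ + C₃) * (p : ℝ) ^ (-(min (2 * α) (β + 1 / 2))) :=
        mul_le_mul (by linarith) h3 (by positivity) (by positivity)
      refine (abs_add_le _ _).trans ?_
      linarith
    · intro τ hτ
      obtain ⟨h1, h2⟩ := hF3 τ hτ
      have h3 := rpow_neg_le_rpow_neg hp (min_le_min_right (β + 1 / 2)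
        (by linarith : 2 * α ≤ 2 * β))
      have h4 : C₃ * (p : ℝ) ^ (-(min (2 * β) (β + 1 / 2))) ≤
          (C₁ + C₃) * (p : ℝ) ^ (-(min (2 * α) (β + 1 / 2))) :=
        mul_le_mul (by linarith) h3 (by positivity) (by positivity)
      refine (abs_add_le _ _).trans ?_
      linarith
  · rw [h.eval_neg_one_sub hα hβ0, abs_mul]
    set e := min (2 * β) (β + 1 / 2)
    have := abs_sum_add_integral_le (m := m) (d := d)
      (A := fun i => fracF (α + i) (p + 1) 1 - fracF (α + i) p 1)
      (G := fun τ => fracF β (p + 1) τ - fracF β p τ)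
      (B := (C₂ + 2 * C₃) * (p : ℝ) ^ (-(min (2 * α + 1) e))) h.int ?_ ?_
    · have e1 : |-((-1 : ℝ) ^ p / 2)| = 1 / 2 := by
        rw [abs_neg, abs_div, abs_pow]; norm_num
      rw [e1]
      have : 0 ≤ (C₂ + 2 * C₃) * (p : ℝ) ^ (-(min (2 * α + 1) e)) * U := by positivity
      linarith
    · intro i hi
      refine (h₂ i hi p hp).trans ?_
      exact mul_le_mul (by linarith) (rpow_neg_le_rpow_neg hp (min_le_left _ _))
        (by positivity) (by positivity)
    · intro τ hτ
      obtain ⟨h1, h2⟩ := hF3 τ hτ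
      have h3 := rpow_neg_le_rpow_neg hp (min_le_right (2 * α + 1) e)
      have h4 : 2 * C₃ * (p : ℝ) ^ (-e) ≤ (C₂ + 2 * C₃) * (p : ℝ) ^ (-(min (2 * α + 1) e)) :=
        mul_le_mul (by linarith) h3 (by positivity) (by positivity)
      refine (abs_sub _ _).trans ?_
      linarith

lemma sqrt_integral_legendreProj_add_le {f : ℝ → ℝ} (hf : ContinuousOn f (Icc (-1) 1)) {p : ℕ}
    (hp : 1 ≤ p) (κ : ℝ) :
    Real.sqrt (∫ t in (-1 : ℝ)..1,
      ((legendreProj f p + Polynomial.C κ * legendreP p).eval t - f t) ^ 2) ≤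
    2 * (Real.sqrt (∫ t in (-1 : ℝ)..1, (f t - (legendreProj f p).eval t) ^ 2) +
      |κ| * (p : ℝ) ^ (-(1 / 2 : ℝ))) := by
  have hp0 : (0 : ℝ) < p := by exact_mod_cast hp
  set S := legendreProj f p with hS
  set I := ∫ t in (-1 : ℝ)..1, (f t - S.eval t) ^ 2 with hI
  have hI0 : 0 ≤ I := intervalIntegral.integral_nonneg (by norm_num) fun _ _ => sq_nonneg _
  have hi1 : IntervalIntegrable (fun t => (f t - S.eval t) ^ 2) volume (-1) 1 := by
    apply ContinuousOn.intervalIntegrable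
    rw [uIcc_of_le (by norm_num)]
    exact (hf.sub S.continuous.continuousOn).pow 2
  have hi2 : IntervalIntegrable
      (fun t => ((S + Polynomial.C κ * legendreP p).eval t - f t) ^ 2) volume (-1) 1 := by
    apply ContinuousOn.intervalIntegrable
    rw [uIcc_of_le (by norm_num)]
    exact ((Polynomial.continuous _).continuousOn.sub hf).pow 2
  have hi3 := intervalIntegrable_poly_mul (legendreP p) (legendreP p)
  have h1 : ∫ t in (-1 : ℝ)..1, ((S + Polynomial.C κ * legendreP p).eval t - f t) ^ 2 ≤
      2 * I + 2 * κ ^ 2 * (2 / (2 * p + 1)) := by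
    rw [← integral_legendreP_sq, hI, ← intervalIntegral.integral_const_mul,
      ← intervalIntegral.integral_const_mul,
      ← intervalIntegral.integral_add (hi1.const_mul _) (hi3.const_mul _)]
    refine intervalIntegral.integral_mono_on (by norm_num) hi2
      ((hi1.const_mul _).add (hi3.const_mul _)) fun t _ => ?_
    simp only [Polynomial.eval_add, Polynomial.eval_mul, Polynomial.eval_C]
    nlinarith [sq_nonneg ((f t - S.eval t) + κ * (legendreP p).eval t)]
  have h2 : (2 : ℝ) / (2 * p + 1) ≤ 1 / p := by
    rw [div_le_div_iff₀ (by positivity) hp0]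
    linarith
  have h3 : ((p : ℝ) ^ (-(1 / 2 : ℝ))) ^ 2 = 1 / p := by
    rw [← Real.rpow_natCast, ← Real.rpow_mul hp0.le]
    norm_num [Real.rpow_neg_one]
  apply Real.sqrt_le_iff.mpr
  refine ⟨by positivity, h1.trans ?_⟩
  have h4 : 2 * κ ^ 2 * (2 / (2 * p + 1)) ≤ 2 * κ ^ 2 * (1 / p) :=
    mul_le_mul_of_nonneg_left h2 (by positivity)
  have h5 : 0 ≤ Real.sqrt I * (|κ| * (p : ℝ) ^ (-(1 / 2 : ℝ))) := by positivity
  have h6 : (|κ| * (p : ℝ) ^ (-(1 / 2 : ℝ))) ^ 2 = κ ^ 2 * (1 / p) := by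
    rw [mul_pow, sq_abs, h3]
  have h7 : 0 ≤ κ ^ 2 * (1 / (p : ℝ)) := by positivity
  nlinarith [Real.sq_sqrt hI0]

/-- Errors of the Gauss–Radau projections of a singular function on the reference interval. -/
lemma exists_radau_bounds (m : ℕ) {α β : ℝ} (hα : 0 < α) (hβ : α ≤ β) :
    ∃ C > (0 : ℝ), ∀ p : ℕ, 1 ≤ p → β ≤ p → ∀ (f : ℝ → ℝ) (d : ℕ → ℝ) (ψ : ℝ → ℝ),
      SingularRep m α β f d ψ → ∀ P : Polynomial ℝ, P.natDegree ≤ p →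
      (∀ n < p, ∫ t in (-1 : ℝ)..1, (P.eval t - f t) * (legendreP n).eval t = 0) →
      (P.eval 1 = f 1 →
        Real.sqrt (∫ t in (-1 : ℝ)..1, (P.eval t - f t) ^ 2) ≤
          C * (p : ℝ) ^ (-(min (2 * α + 1 / 2) (β + 1 / 2))) * singularMass m d ψ ∧
        |P.eval (-1) - f (-1)| ≤
          C * (p : ℝ) ^ (-(min (2 * α) (β + 1 / 2))) * singularMass m d ψ) ∧
      (P.eval (-1) = f (-1) →
        Real.sqrt (∫ t in (-1 : ℝ)..1, (P.eval t - f t) ^ 2) ≤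
          C * (p : ℝ) ^ (-(min (2 * α + 1) (β + 1 / 2))) * singularMass m d ψ ∧
        |P.eval 1 - f 1| ≤
          C * (p : ℝ) ^ (-(min (2 * α) (β + 1 / 2))) * singularMass m d ψ) := by
  obtain ⟨C, hC, hb⟩ := exists_legendreProj_bounds m hα hβ
  refine ⟨4 * C, by positivity, fun p hp hβp f d ψ h P hP horth => ?_⟩
  have hp0 : (0 : ℝ) < p := by exact_mod_cast hp
  obtain ⟨hL, h1, h2⟩ := hb p hp hβp f d ψ h
  obtain ⟨κ, rfl⟩ := exists_eq_legendreProj_add h.cont hP horth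
  have hU := singularMass_nonneg m d ψ
  set U := singularMass m d ψ
  set S := legendreProj f p
  have hκ := sqrt_integral_legendreProj_add_le h.cont hp κ
  set A := Real.sqrt (∫ t in (-1 : ℝ)..1, (f t - S.eval t) ^ 2)
  have mono : ∀ {x e e' : ℝ}, x ≤ C * (p : ℝ) ^ (-e') * U → e ≤ e' →
      x ≤ C * (p : ℝ) ^ (-e) * U := fun hx he => hx.trans (mul_le_mul_of_nonneg_right
    (mul_le_mul_of_nonneg_left (rpow_neg_le_rpow_neg hp he) hC.le) hU)
  have half : ∀ {x e : ℝ}, x ≤ C * (p : ℝ) ^ (-e) * U →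
      x * (p : ℝ) ^ (-(1 / 2 : ℝ)) ≤ C * (p : ℝ) ^ (-(e + 1 / 2)) * U := by
    intro x e hx
    refine (mul_le_mul_of_nonneg_right hx (by positivity)).trans (le_of_eq ?_)
    rw [show -(e + 1 / 2) = -e + -(1 / 2) by ring, Real.rpow_add hp0]
    ring
  have hsgn : |κ * (-1) ^ p| = |κ| := by rw [abs_mul, abs_pow]; norm_num
  simp only [Polynomial.eval_add, Polynomial.eval_mul, Polynomial.eval_C, legendreP_eval_one,
    legendreP_eval_neg_one, mul_one] at hκ ⊢
  have m1 := min_le_left (2 * α) (β + 1 / 2)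
  have m2 := min_le_right (2 * α) (β + 1 / 2)
  have hend : min (2 * α) (β + 1 / 2) ≤ min (2 * α + 1) (min (2 * β) (β + 1 / 2)) :=
    le_min (by linarith) (le_min (by linarith) m2)
  have hpos : ∀ e : ℝ, 0 ≤ C * (p : ℝ) ^ (-e) * U := fun e => by positivity
  refine ⟨fun he => ⟨?_, ?_⟩, fun he => ⟨?_, ?_⟩⟩
  · have hk : |κ| ≤ C * (p : ℝ) ^ (-(min (2 * α) (β + 1 / 2))) * U := by
      rwa [show κ = f 1 - S.eval 1 by linarith]
    have e1 := mono (e := min (2 * α + 1 / 2) (β + 1 / 2)) (half hk)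
      (by rw [← min_add_add_right]; exact min_le_min le_rfl (by linarith))
    have e2 := mono (e := min (2 * α + 1 / 2) (β + 1 / 2)) hL
      (min_le_min (by linarith) le_rfl)
    linarith
  · have hk : |κ| ≤ C * (p : ℝ) ^ (-(min (2 * α) (β + 1 / 2))) * U := by
      rwa [show κ = f 1 - S.eval 1 by linarith]
    have e2 := mono (e := min (2 * α) (β + 1 / 2)) h2 hend
    have := abs_add_le (κ * (-1) ^ p) (-(f (-1) - S.eval (-1)))
    rw [hsgn, abs_neg] at this
    rw [show S.eval (-1) + κ * (-1) ^ p - f (-1) =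
      κ * (-1) ^ p + -(f (-1) - S.eval (-1)) by ring]
    linarith [hpos (min (2 * α) (β + 1 / 2))]
  · have hk : |κ| ≤ C * (p : ℝ) ^ (-(min (2 * α + 1) (min (2 * β) (β + 1 / 2)))) * U := by
      rwa [← hsgn, show κ * (-1) ^ p = f (-1) - S.eval (-1) by linarith]
    have e1 := mono (e := min (2 * α + 1) (β + 1 / 2)) (half hk) (by
      rw [← min_add_add_right, ← min_add_add_right]
      refine le_min ?_ (le_min ?_ ?_)
      · linarith [min_le_left (2 * α + 1) (β + 1 / 2)]
      · linarith [min_le_right (2 * α + 1) (β + 1 / 2)]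
      · linarith [min_le_right (2 * α + 1) (β + 1 / 2)])
    linarith
  · have hk : |κ| ≤ C * (p : ℝ) ^ (-(min (2 * α + 1) (min (2 * β) (β + 1 / 2)))) * U := by
      rwa [← hsgn, show κ * (-1) ^ p = f (-1) - S.eval (-1) by linarith]
    have e1 := mono (e := min (2 * α) (β + 1 / 2)) hk hend
    have := abs_add_le κ (-(f 1 - S.eval 1))
    rw [abs_neg] at this
    rw [show S.eval 1 + κ - f 1 = κ + -(f 1 - S.eval 1) by ring]
    linarith [hpos (min (2 * α) (β + 1 / 2))]

lemma intervalIntegrable_sub_rpow_mul_sub_rpow {p q x z : ℝ} (hp : 0 < p) (hq : 0 < q)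
    (hxz : x < z) :
    IntervalIntegrable (fun t : ℝ => (t - x) ^ (p - 1) * (z - t) ^ (q - 1)) volume x z := by
  have h1 : ∀ c d : ℝ, IntervalIntegrable (fun t : ℝ => (t - x) ^ (p - 1)) volume c d := by
    intro c d
    have := (intervalIntegral.intervalIntegrable_rpow' (a := c - x) (b := d - x)
      (r := p - 1) (by linarith)).comp_sub_right x
    simpa using this
  have h2 : ∀ c d : ℝ, IntervalIntegrable (fun t : ℝ => (z - t) ^ (q - 1)) volume c d :=
    fun c d => intervalIntegrable_sub_rpow (by linarith) c d z
  have hm : x < (x + z) / 2 ∧ (x + z) / 2 < z := ⟨by linarith, by linarith⟩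
  refine IntervalIntegrable.trans (b := (x + z) / 2) ?_ ?_
  · refine (h1 _ _).mul_continuousOn ?_
    refine (continuous_const.sub continuous_id).continuousOn.rpow_const fun t ht => Or.inl ?_
    rw [uIcc_of_le hm.1.le] at ht
    have : 0 < z - t := by linarith [ht.2]
    exact this.ne'
  · refine (h2 _ _).continuousOn_mul ?_
    refine (continuous_id.sub continuous_const).continuousOn.rpow_const fun t ht => Or.inl ?_
    rw [uIcc_of_le hm.2.le] at ht
    have : 0 < t - x := by linarith [ht.1]
    exact this.ne'

lemma integral_sub_rpow_mul_sub_rpow {p q x z : ℝ} (hp : 0 < p) (hq : 0 < q) (hxz : x < z) :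
    ∫ t in x..z, (t - x) ^ (p - 1) * (z - t) ^ (q - 1) =
      ProbabilityTheory.beta p q * (z - x) ^ (p + q - 1) := by
  have ha : 0 < z - x := sub_pos.mpr hxz
  have h := intervalIntegral.integral_comp_sub_right
    (fun s : ℝ => s ^ (p - 1) * (z - x - s) ^ (q - 1)) x (a := x) (b := z)
  rw [sub_self] at h
  have e : ∫ t in x..z, (t - x) ^ (p - 1) * (z - t) ^ (q - 1) =
      ∫ t in x..z, (t - x) ^ (p - 1) * (z - x - (t - x)) ^ (q - 1) := by
    congr 1; ext t; rw [sub_sub_sub_cancel_right]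
  rw [e, h]
  have hc := Complex.betaIntegral_scaled p q ha
  rw [Complex.betaIntegral_eq_Gamma_mul_div _ _ (by simpa) (by simpa)] at hc
  have hl : ∫ s in (0 : ℝ)..(z - x), (s : ℂ) ^ ((p : ℂ) - 1) *
      (((z - x : ℝ) : ℂ) - s) ^ ((q : ℂ) - 1) =
      ((∫ s in (0 : ℝ)..(z - x), s ^ (p - 1) * (z - x - s) ^ (q - 1) : ℝ) : ℂ) := by
    rw [← intervalIntegral.integral_ofReal]
    refine intervalIntegral.integral_congr fun s hs => ?_
    rw [uIcc_of_le ha.le] at hs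
    push_cast
    rw [Complex.ofReal_cpow hs.1, Complex.ofReal_cpow (by linarith [hs.2])]
    push_cast
    rfl
  rw [hl] at hc
  apply Complex.ofReal_injective
  rw [hc, ProbabilityTheory.beta, ← Complex.ofReal_add p q, Complex.Gamma_ofReal,
    Complex.Gamma_ofReal, Complex.Gamma_ofReal]
  push_cast
  rw [Complex.ofReal_cpow (by linarith)]
  push_cast
  ring

/-- Composition of one-sided fractional integrals. -/
lemma fractional_integral_comp {p q x b : ℝ} (hp : 0 < p) (hq : 0 < q) (hpq : 1 ≤ p + q)
    (hxb : x ≤ b) {v : ℝ → ℝ} (hv : IntervalIntegrable v volume x b) :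
    IntervalIntegrable (fun t => (t - x) ^ (p - 1) * ∫ z in t..b, (z - t) ^ (q - 1) * v z)
      volume x b ∧
    ∫ t in x..b, (t - x) ^ (p - 1) * (∫ z in t..b, (z - t) ^ (q - 1) * v z) =
      ProbabilityTheory.beta p q * ∫ z in x..b, (z - x) ^ (p + q - 1) * v z := by
  set μ : Measure ℝ := volume.restrict (Ioc x b) with hμ
  have hvμ : Integrable v μ := (intervalIntegrable_iff_integrableOn_Ioc_of_le hxb).mp hv
  set T : Set (ℝ × ℝ) := {w | w.1 < w.2} with hT
  have hTm : MeasurableSet T := measurableSet_lt measurable_fst measurable_snd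
  set K : ℝ × ℝ → ℝ := T.indicator
    (fun w => (w.1 - x) ^ (p - 1) * ((w.2 - w.1) ^ (q - 1) * v w.2)) with hK
  have hKm : AEStronglyMeasurable K (μ.prod μ) := by
    refine AEStronglyMeasurable.indicator ?_ hTm
    have m1 : Measurable fun w : ℝ × ℝ => (w.1 - x) ^ (p - 1) :=
      (measurable_fst.sub_const x).pow_const _
    have m2 : Measurable fun w : ℝ × ℝ => (w.2 - w.1) ^ (q - 1) :=
      (measurable_snd.sub measurable_fst).pow_const _
    exact m1.aestronglyMeasurable.mul
      (m2.aestronglyMeasurable.mul hvμ.aestronglyMeasurable.comp_snd)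
  -- the section at a fixed outer variable
  have hrow : ∀ t ∈ Ioc x b, ∫ z, K (t, z) ∂μ =
      (t - x) ^ (p - 1) * ∫ z in t..b, (z - t) ^ (q - 1) * v z := by
    intro t ht
    have e : (fun z => K (t, z)) =
        (Ioi t).indicator (fun z => (t - x) ^ (p - 1) * ((z - t) ^ (q - 1) * v z)) := by
      ext z
      simp [hK, hT, indicator]
    rw [e, hμ, setIntegral_indicator measurableSet_Ioi, Ioc_inter_Ioi, max_eq_right ht.1.le,
      intervalIntegral.integral_of_le ht.2, integral_const_mul]
  have hcol : ∀ z, (fun t => K (t, z)) =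
      (Iio z).indicator (fun t => (t - x) ^ (p - 1) * (z - t) ^ (q - 1) * v z) := by
    intro z
    ext t
    simp [hK, hT, indicator, mul_assoc]
  have hinter : ∀ z ∈ Ioc x b, Ioc x b ∩ Iio z = Ioo x z := by
    intro z hz
    ext t
    simp only [mem_inter_iff, mem_Ioc, mem_Iio, mem_Ioo]
    exact ⟨fun h => ⟨h.1.1, h.2⟩, fun h => ⟨⟨h.1, (h.2.trans_le hz.2).le⟩, h.2⟩⟩
  have hbeta := fun z (hz : z ∈ Ioc x b) => intervalIntegrable_sub_rpow_mul_sub_rpow hp hq hz.1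
  have hcolint : ∀ z ∈ Ioc x b, Integrable (fun t => K (t, z)) μ := by
    intro z hz
    rw [hcol, integrable_indicator_iff measurableSet_Iio, IntegrableOn, hμ,
      Measure.restrict_restrict measurableSet_Iio, inter_comm, hinter z hz]
    exact ((intervalIntegrable_iff_integrableOn_Ioo_of_le hz.1.le).mp (hbeta z hz)).mul_const _
  have hcoleq : ∀ z ∈ Ioc x b, ∫ t, K (t, z) ∂μ =
      ProbabilityTheory.beta p q * ((z - x) ^ (p + q - 1) * v z) := by
    intro z hz
    rw [hcol, hμ, setIntegral_indicator measurableSet_Iio, hinter z hz, integral_mul_const,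
      ← integral_Ioc_eq_integral_Ioo, ← intervalIntegral.integral_of_le hz.1.le,
      integral_sub_rpow_mul_sub_rpow hp hq hz.1]
    ring
  have hcolnorm : ∀ z ∈ Ioc x b, ∫ t, ‖K (t, z)‖ ∂μ =
      ProbabilityTheory.beta p q * ((z - x) ^ (p + q - 1) * |v z|) := by
    intro z hz
    have e : (fun t => ‖K (t, z)‖) =ᵐ[μ]
        (Iio z).indicator (fun t => (t - x) ^ (p - 1) * (z - t) ^ (q - 1) * |v z|) := by
      refine (ae_restrict_iff' measurableSet_Ioc).mpr (Eventually.of_forall fun t ht => ?_)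
      change ‖(fun t => K (t, z)) t‖ = _
      rw [hcol, norm_indicator_eq_indicator_norm]
      by_cases htz : t ∈ Iio z
      · rw [indicator_of_mem htz, indicator_of_mem htz, norm_mul, Real.norm_eq_abs,
          Real.norm_eq_abs, abs_of_nonneg]
        exact mul_nonneg (Real.rpow_nonneg (by linarith [ht.1]) _)
          (Real.rpow_nonneg (by linarith [show t < z from htz]) _)
      · rw [indicator_of_notMem htz, indicator_of_notMem htz]
    rw [integral_congr_ae e, hμ, setIntegral_indicator measurableSet_Iio, hinter z hz,
      integral_mul_const, ← integral_Ioc_eq_integral_Ioo,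
      ← intervalIntegral.integral_of_le hz.1.le, integral_sub_rpow_mul_sub_rpow hp hq hz.1]
    ring
  have hKi : Integrable K (μ.prod μ) := by
    rw [integrable_prod_iff' hKm]
    refine ⟨(ae_restrict_iff' measurableSet_Ioc).mpr (Eventually.of_forall hcolint), ?_⟩
    have hi : IntervalIntegrable (fun z => ProbabilityTheory.beta p q *
        ((z - x) ^ (p + q - 1) * |v z|)) volume x b := by
      refine (hv.abs.continuousOn_mul ?_).const_mul _
      exact ((continuous_id.sub continuous_const).rpow_const
        fun _ => Or.inr (by linarith)).continuousOn
    refine ((intervalIntegrable_iff_integrableOn_Ioc_of_le hxb).mp hi).congr ?_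
    exact (ae_restrict_iff' measurableSet_Ioc).mpr
      (Eventually.of_forall fun z hz => (hcolnorm z hz).symm)
  constructor
  · rw [intervalIntegrable_iff_integrableOn_Ioc_of_le hxb]
    exact hKi.integral_prod_left.congr ((ae_restrict_iff' measurableSet_Ioc).mpr
      (Eventually.of_forall hrow))
  · rw [intervalIntegral.integral_of_le hxb, intervalIntegral.integral_of_le hxb,
      ← setIntegral_congr_fun measurableSet_Ioc hrow,
      integral_integral_swap (f := fun t z => K (t, z)) hKi,
      setIntegral_congr_fun measurableSet_Ioc hcoleq, integral_const_mul]

lemma exists_tendsto_left_of_hasDerivAt {a b : ℝ} (hab : a < b) {f f' : ℝ → ℝ}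
    (hd : ∀ x ∈ Ioo a b, HasDerivAt f (f' x) x) (hi : IntervalIntegrable f' volume a b) :
    ∃ l, Tendsto f (nhdsWithin b (Iio b)) (nhds l) := by
  set c := (a + b) / 2 with hc
  have hac : a < c := by linarith
  have hcb : c < b := by linarith
  have hi' : IntervalIntegrable f' volume c b := hi.mono_set (by
    rw [uIcc_of_le hcb.le, uIcc_of_le hab.le]; exact Icc_subset_Icc_left hac.le)
  have hcont := intervalIntegral.continuousOn_primitive_interval
    (μ := volume) (f := f') (a := c) (b := b)
    (by rw [uIcc_of_le hcb.le]; exact (intervalIntegrable_iff_integrableOn_Icc_of_le hcb.le).mp hi')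
  rw [uIcc_of_le hcb.le] at hcont
  have h1 : Tendsto (fun y => f c + ∫ t in c..y, f' t) (nhdsWithin b (Iio b))
      (nhds (f c + ∫ t in c..b, f' t)) := by
    refine tendsto_const_nhds.add ?_
    have := (hcont b ⟨hcb.le, le_rfl⟩).mono Ioo_subset_Icc_self
    rwa [ContinuousWithinAt, nhdsWithin_Ioo_eq_nhdsLT hcb] at this
  refine ⟨_, h1.congr' ?_⟩
  filter_upwards [Ioo_mem_nhdsLT hcb] with y hy
  have hsub : uIcc c y ⊆ Ioo a b := by
    rw [uIcc_of_le hy.1.le]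
    exact fun t ht => ⟨hac.trans_le ht.1, ht.2.trans_lt hy.2⟩
  rw [intervalIntegral.integral_eq_sub_of_hasDerivAt (fun t ht => hd t (hsub ht))
    (hi.mono_set (by
      rw [uIcc_of_le hab.le]
      exact hsub.trans Ioo_subset_Icc_self))]
  ring

/-- Taylor's formula at the right endpoint with integral remainder. -/
lemma taylor_right_endpoint {a b : ℝ} {F : ℕ → ℝ → ℝ} {L : ℕ → ℝ} (n : ℕ)
    (hd : ∀ i < n + 1, ∀ x ∈ Ioo a b, HasDerivAt (F i) (F (i + 1) x) x)
    (hi : ∀ i ≤ n + 1, IntervalIntegrable (F i) volume a b)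
    (hl : ∀ i < n + 1, Tendsto (F i) (nhdsWithin b (Iio b)) (nhds (L i)))
    {x : ℝ} (hx : x ∈ Ioo a b) :
    F 0 x = ∑ i ∈ Finset.range (n + 1), (-1) ^ i * L i * (b - x) ^ i / i.factorial +
      (-1) ^ (n + 1) / n.factorial * ∫ y in x..b, (y - x) ^ n * F (n + 1) y := by
  have hi' : ∀ i ≤ n + 1, IntervalIntegrable (F i) volume x b := fun i hin =>
    (hi i hin).mono_set (by
      rw [uIcc_of_le hx.2.le, uIcc_of_le (hx.1.trans hx.2).le]
      exact Icc_subset_Icc_left hx.1.le)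
  have hright : ∀ i < n + 1, Tendsto (F i) (nhdsWithin x (Ioi x)) (nhds (F i x)) := fun i hin =>
    ((hd i hin x hx).continuousAt.tendsto).mono_left nhdsWithin_le_nhds
  induction n with
  | zero =>
    have h := intervalIntegral.integral_eq_sub_of_hasDerivAt_of_tendsto hx.2
      (fun y hy => hd 0 (by omega) y ⟨hx.1.trans hy.1, hy.2⟩) (hi' 1 le_rfl)
      (hright 0 (by omega)) (hl 0 (by omega))
    simp only [zero_add, Finset.sum_range_one, pow_zero, one_mul, mul_one, Nat.factorial_zero,
      Nat.cast_one, div_one, pow_one, neg_mul] at h ⊢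
    rw [h]
    ring
  | succ n ih =>
    rw [ih (fun i h => hd i (by omega)) (fun i h => hi i (by omega))
      (fun i h => hl i (by omega)) (fun i h => hi' i (by omega))
      (fun i h => hright i (by omega)), Finset.sum_range_succ _ (n + 1), add_assoc]
    congr 1
    have hi1 : IntervalIntegrable (fun y => (y - x) ^ n * F (n + 1) y) volume x b :=
      (hi' (n + 1) (by omega)).continuousOn_mul (by fun_prop)
    have hi2 : IntervalIntegrable (fun y => (y - x) ^ (n + 1) * F (n + 1 + 1) y) volume x b :=
      (hi' (n + 2) le_rfl).continuousOn_mul (by fun_prop)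
    have hc : Continuous fun y : ℝ => (y - x) ^ (n + 1) := by fun_prop
    have h := intervalIntegral.integral_eq_sub_of_hasDerivAt_of_tendsto hx.2
      (f := fun y => (y - x) ^ (n + 1) * F (n + 1) y)
      (f' := fun y => (n + 1) * ((y - x) ^ n * F (n + 1) y) + (y - x) ^ (n + 1) * F (n + 1 + 1) y)
      (fun y hy => by
        have h1 := ((hasDerivAt_id y).sub_const x).pow (n + 1)
        refine (h1.mul (hd (n + 1) (by omega) y ⟨hx.1.trans hy.1, hy.2⟩)).congr_deriv ?_
        simp only [id, Pi.pow_apply]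
        push_cast
        ring)
      ((hi1.const_mul _).add hi2)
      ((hc.continuousAt.tendsto.mono_left nhdsWithin_le_nhds).mul (hright (n + 1) (by omega)))
      ((hc.continuousAt.tendsto.mono_left nhdsWithin_le_nhds).mul (hl (n + 1) (by omega)))
    rw [intervalIntegral.integral_add (hi1.const_mul _) hi2,
      intervalIntegral.integral_const_mul, sub_self, zero_pow (by omega), zero_mul] at h
    have hf : (n.factorial : ℝ) ≠ 0 := by exact_mod_cast n.factorial_ne_zero
    have hn : (n + 1 : ℝ) ≠ 0 := by positivity
    rw [Nat.factorial_succ]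
    push_cast
    field_simp
    linear_combination (-1) ^ (n + 1) * h

/-- A function of `𝒰^{α,m}` is a polynomial plus a singular part governed by its Caputo
derivative. -/
lemma exists_caputoR_representation {k m : ℕ} (hk : 1 ≤ k) (hm : 1 ≤ m) {α : ℝ} (hα0 : 0 < α)
    (hαk : α < k) :
    ∃ (e : ℕ → ℝ) (c : ℝ), ∀ (a b : ℝ) (ω : ℝ → ℝ) (L : ℕ → ℝ), a < b →
      MemUROn k m α a b ω L → ∃ q : Polynomial ℝ, q.natDegree < k ∧ ∀ x ∈ Ioo a b,
        ω x = q.eval x + (∑ i ∈ Finset.range m, e i * L i * (b - x) ^ (α + i) +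
          c * ∫ y in x..b, (y - x) ^ (α + m - 1) * iteratedDeriv m (caputoR k α b ω) y) := by
  obtain ⟨k, rfl⟩ : ∃ k', k = k' + 1 := ⟨k - 1, by omega⟩
  obtain ⟨m, rfl⟩ : ∃ m', m = m' + 1 := ⟨m - 1, by omega⟩
  push_cast at hαk
  refine ⟨fun i => 1 / Real.Gamma α * ((-1) ^ i / i.factorial *
    ProbabilityTheory.beta α (i + 1)), 1 / Real.Gamma α * ((-1) ^ (m + 1) / m.factorial *
    ProbabilityTheory.beta α (m + 1)), fun a b ω L hab h => ?_⟩
  obtain ⟨-, hd, hi, hgd, hgi, hgl⟩ := h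
  choose! M hM using fun i (hik : i < k + 1) =>
    exists_tendsto_left_of_hasDerivAt hab (hd i hik) (hi (i + 1) hik)
  refine ⟨∑ i ∈ Finset.range (k + 1), Polynomial.C ((-1) ^ i * M i / i.factorial) *
    (Polynomial.C b - Polynomial.X) ^ i, ?_, fun x hx => ?_⟩
  · refine Nat.lt_succ_of_le (Polynomial.natDegree_sum_le_of_forall_le _ _ fun i hik => ?_)
    refine (Polynomial.natDegree_C_mul_le _ _).trans ?_
    refine Polynomial.natDegree_pow_le.trans ?_
    have h1 : (Polynomial.C b - Polynomial.X : Polynomial ℝ).natDegree ≤ 1 :=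
      (Polynomial.natDegree_sub_le _ _).trans (by simp)
    have h2 := Finset.mem_range.mp hik
    nlinarith
  have hxb : uIcc x b ⊆ uIcc a b := by
    rw [uIcc_of_le hx.2.le, uIcc_of_le hab.le]
    exact Icc_subset_Icc_left hx.1.le
  set g := caputoR (k + 1) α b ω with hg
  set v := iteratedDeriv (k + 1) ω with hv
  set G := iteratedDeriv (m + 1) g with hG
  have hΓ : Real.Gamma α ≠ 0 := (Real.Gamma_pos_of_pos hα0).ne'
  have hΓ' : Real.Gamma ((k : ℝ) + 1 - α) ≠ 0 := (Real.Gamma_pos_of_pos (by linarith)).ne'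
  have T1 := taylor_right_endpoint (F := fun i => iteratedDeriv i ω) k hd hi hM hx
  have A := (fractional_integral_comp hα0 (by linarith : 0 < (k : ℝ) + 1 - α)
    (by linarith [k.cast_nonneg (α := ℝ)]) hx.2.le ((hi (k + 1) le_rfl).mono_set hxb)).2
  have hAbel : ∫ t in x..b, (t - x) ^ (α - 1) * g t =
      Real.Gamma α * ((-1) ^ (k + 1) / k.factorial * ∫ y in x..b, (y - x) ^ k * v y) := by
    have e1 : ∀ t, (t - x) ^ (α - 1) * g t = (-1) ^ (k + 1) / Real.Gamma ((k : ℝ) + 1 - α) *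
        ((t - x) ^ (α - 1) * ∫ z in t..b, (z - t) ^ ((k : ℝ) + 1 - α - 1) * v z) := by
      intro t
      simp only [hg, caputoR]
      push_cast
      ring
    simp only [e1]
    rw [intervalIntegral.integral_const_mul, A, ProbabilityTheory.beta,
      show α + ((k : ℝ) + 1 - α) = k + 1 by ring, Real.Gamma_nat_eq_factorial,
      add_sub_cancel_right]
    simp only [Real.rpow_natCast]
    have hf : (k.factorial : ℝ) ≠ 0 := by exact_mod_cast k.factorial_ne_zero
    field_simp
    rfl
  obtain ⟨hBi, hB⟩ := fractional_integral_comp hα0 (by positivity : 0 < (m : ℝ) + 1)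
    (by linarith [m.cast_nonneg (α := ℝ)]) hx.2.le ((hgi (m + 1) le_rfl).mono_set hxb)
  simp only [add_sub_cancel_right, Real.rpow_natCast] at hBi hB
  have hpow : ∀ i : ℕ, IntervalIntegrable (fun t => (t - x) ^ (α - 1) * (b - t) ^ i)
      volume x b ∧ ∫ t in x..b, (t - x) ^ (α - 1) * (b - t) ^ i =
        ProbabilityTheory.beta α (i + 1) * (b - x) ^ (α + i) := by
    intro i
    have h1 := intervalIntegrable_sub_rpow_mul_sub_rpow hα0 (by positivity : 0 < (i : ℝ) + 1) hx.2
    have h2 := integral_sub_rpow_mul_sub_rpow hα0 (by positivity : 0 < (i : ℝ) + 1) hx.2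
    simp only [add_sub_cancel_right, Real.rpow_natCast] at h1 h2
    exact ⟨h1, by rw [h2, add_sub_assoc, add_sub_cancel_right]⟩
  have hg2 : ∫ t in x..b, (t - x) ^ (α - 1) * g t =
      ∑ i ∈ Finset.range (m + 1), (-1) ^ i * L i / i.factorial *
        (ProbabilityTheory.beta α (i + 1) * (b - x) ^ (α + i)) +
      (-1) ^ (m + 1) / m.factorial * (ProbabilityTheory.beta α (m + 1) *
        ∫ z in x..b, (z - x) ^ (α + m) * G z) := by
    have e1 : ∫ t in x..b, (t - x) ^ (α - 1) * g t = ∫ t in x..b,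
        (∑ i ∈ Finset.range (m + 1), (-1) ^ i * L i / i.factorial *
          ((t - x) ^ (α - 1) * (b - t) ^ i) + (-1) ^ (m + 1) / m.factorial *
          ((t - x) ^ (α - 1) * ∫ z in t..b, (z - t) ^ m * G z)) := by
      rw [intervalIntegral.integral_of_le hx.2.le, intervalIntegral.integral_of_le hx.2.le,
        integral_Ioc_eq_integral_Ioo, integral_Ioc_eq_integral_Ioo]
      refine setIntegral_congr_fun measurableSet_Ioo fun t ht => ?_
      have T2 := taylor_right_endpoint (F := fun i => iteratedDeriv i g) m hgd hgi hgl
        (x := t) ⟨hx.1.trans ht.1, ht.2⟩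
      simp only [iteratedDeriv_zero] at T2
      rw [T2, mul_add, Finset.mul_sum]
      congr 1
      · exact Finset.sum_congr rfl fun i _ => by ring
      · ring
    have hs : ∀ i ∈ Finset.range (m + 1), IntervalIntegrable (fun t =>
        (-1) ^ i * L i / i.factorial * ((t - x) ^ (α - 1) * (b - t) ^ i)) volume x b :=
      fun i _ => (hpow i).1.const_mul _
    have hs' : IntervalIntegrable (fun t => ∑ i ∈ Finset.range (m + 1),
        (-1) ^ i * L i / i.factorial * ((t - x) ^ (α - 1) * (b - t) ^ i)) volume x b := by
      have := IntervalIntegrable.sum _ hs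
      rwa [Finset.sum_fn] at this
    rw [e1, intervalIntegral.integral_add hs' (hBi.const_mul _),
      intervalIntegral.integral_finsetSum hs, intervalIntegral.integral_const_mul, hB]
    congr 1
    · refine Finset.sum_congr rfl fun i _ => ?_
      rw [intervalIntegral.integral_const_mul, (hpow i).2]
    · rw [add_sub_assoc, add_sub_cancel_right]
  simp only [iteratedDeriv_zero] at T1
  rw [T1, Polynomial.eval_finsetSum]
  congr 1
  · refine Finset.sum_congr rfl fun i _ => ?_
    simp only [Polynomial.eval_mul, Polynomial.eval_C, Polynomial.eval_pow, Polynomial.eval_sub,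
      Polynomial.eval_X]
    ring
  · rw [hg2] at hAbel
    have : (-1) ^ (k + 1) / k.factorial * ∫ y in x..b, (y - x) ^ k * v y =
        1 / Real.Gamma α * (Real.Gamma α * ((-1) ^ (k + 1) / k.factorial *
          ∫ y in x..b, (y - x) ^ k * v y)) := by
      field_simp
    rw [this, ← hAbel, mul_add, Finset.mul_sum]
    congr 1
    · exact Finset.sum_congr rfl fun i _ => by ring
    · push_cast
      rw [show α + ((m : ℝ) + 1) - 1 = α + m by ring]
      ring

lemma integral_eq_mul_integral_comp_affine {r : ℝ} (hr : 0 < r) (s : ℝ) (F : ℝ → ℝ) :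
    ∫ y in (s - r)..(s + r), F y = r * ∫ τ in (-1 : ℝ)..1, F (r * τ + s) := by
  rw [intervalIntegral.integral_comp_mul_add _ hr.ne', smul_eq_mul, mul_inv_cancel_left₀ hr.ne']
  congr 1 <;> ring

lemma affine_mem_Icc {r s t : ℝ} (hr : 0 < r) (ht : t ∈ Icc (-1 : ℝ) 1) :
    r * t + s ∈ Icc (s - r) (s + r) :=
  ⟨by nlinarith [ht.1], by nlinarith [ht.2]⟩

lemma intervalIntegrable_comp_affine {r : ℝ} (hr : 0 < r) (s : ℝ) {G : ℝ → ℝ}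
    (hG : IntervalIntegrable G volume (s - r) (s + r)) :
    IntervalIntegrable (fun τ => G (r * τ + s)) volume (-1) 1 := by
  have h := (hG.comp_add_right s).comp_mul_left (c := r)
  have e1 : (s - r - s) / r = -1 := by field_simp; ring
  have e2 : (s + r - s) / r = 1 := by field_simp; ring
  rwa [e1, e2] at h

lemma representation_on_Icc {m : ℕ} {α β a b : ℝ} (hα : 0 < α) (hβ : 0 < β) (hab : a < b)
    {ω G : ℝ → ℝ} {q : Polynomial ℝ} {d : ℕ → ℝ} {c : ℝ} (hω : ContinuousOn ω (Icc a b))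
    (hG : IntervalIntegrable G volume a b)
    (h : ∀ x ∈ Ioo a b, ω x = q.eval x + (∑ i ∈ Finset.range m, d i * (b - x) ^ (α + i) +
      c * ∫ y in x..b, (y - x) ^ β * G y)) :
    ∀ x ∈ Icc a b, ω x = q.eval x + (∑ i ∈ Finset.range m, d i * (b - x) ^ (α + i) +
      c * ∫ y in a..b, G y * (max (y - x) 0) ^ β) := by
  have hk : Continuous fun z : ℝ × ℝ => (max (z.2 - z.1) 0) ^ β :=
    ((continuous_snd.sub continuous_fst).max continuous_const).rpow_const fun _ => Or.inr hβ.le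
  have hint : ∀ x, IntervalIntegrable (fun y => G y * (max (y - x) 0) ^ β) volume a b :=
    fun x => hG.mul_continuousOn (hk.comp (Continuous.prodMk_right x)).continuousOn
  have hcont : ContinuousOn (fun x => ∫ y in a..b, G y * (max (y - x) 0) ^ β) (Icc a b) := by
    intro x _
    refine intervalIntegral.continuousWithinAt_of_dominated_interval
      (bound := fun y => |G y| * (b - a) ^ β) (Eventually.of_forall fun x =>
        (intervalIntegrable_iff.mp (hint x)).aestronglyMeasurable) ?_ (hG.abs.mul_const _)
        (Eventually.of_forall fun y _ => ?_)
    · filter_upwards [self_mem_nhdsWithin] with x hx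
      refine Eventually.of_forall fun y hy => ?_
      rw [uIoc_of_le hab.le] at hy
      rw [norm_mul, Real.norm_eq_abs, Real.norm_eq_abs,
        abs_of_nonneg (Real.rpow_nonneg (le_max_right _ _) β)]
      refine mul_le_mul_of_nonneg_left (Real.rpow_le_rpow (le_max_right _ _) ?_ hβ.le)
        (abs_nonneg _)
      exact max_le (by linarith [hx.1, hy.2]) (by linarith)
    · exact (continuous_const.mul (hk.comp (Continuous.prodMk_left y))).continuousWithinAt
  have hR : ContinuousOn (fun x => q.eval x + (∑ i ∈ Finset.range m, d i * (b - x) ^ (α + i) +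
      c * ∫ y in a..b, G y * (max (y - x) 0) ^ β)) (Icc a b) := by
    refine q.continuous.continuousOn.add (ContinuousOn.add ?_ (continuousOn_const.mul hcont))
    refine Continuous.continuousOn (continuous_finsetSum _ fun i _ => continuous_const.mul ?_)
    exact (continuous_const.sub continuous_id).rpow_const fun _ => Or.inr (by positivity)
  refine Set.EqOn.of_subset_closure (s := Ioo a b) (fun x hx => ?_) hω hR Ioo_subset_Icc_self
    (closure_Ioo hab.ne).ge
  have hs : ∀ {u v : ℝ}, u ∈ Icc a b → v ∈ Icc a b → uIcc u v ⊆ uIcc a b := fun hu hv => by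
    rw [uIcc_of_le hab.le]
    exact (ordConnected_Icc.uIcc_subset hu hv)
  have ha : a ∈ Icc a b := left_mem_Icc.mpr hab.le
  have hb : b ∈ Icc a b := right_mem_Icc.mpr hab.le
  have hx' : x ∈ Icc a b := Ioo_subset_Icc_self hx
  rw [h x hx, ← intervalIntegral.integral_add_adjacent_intervals
    ((hint x).mono_set (hs ha hx')) ((hint x).mono_set (hs hx' hb))]
  have h1 : ∫ y in a..x, G y * (max (y - x) 0) ^ β = 0 := by
    rw [intervalIntegral.integral_congr (g := fun _ => 0)]
    · simp
    · intro y hy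
      rw [uIcc_of_le hx.1.le] at hy
      simp only
      rw [max_eq_right (by linarith [hy.2]), Real.zero_rpow hβ.ne', mul_zero]
  have h2 : ∫ y in x..b, G y * (max (y - x) 0) ^ β = ∫ y in x..b, (y - x) ^ β * G y := by
    refine intervalIntegral.integral_congr fun y hy => ?_
    rw [uIcc_of_le hx.2.le] at hy
    rw [max_eq_left (by linarith [hy.1]), mul_comm]
  rw [h1, h2, zero_add]

lemma singularRep_comp_affine {m : ℕ} {α β r s : ℝ} (hr : 0 < r)
    {f G : ℝ → ℝ} {d : ℕ → ℝ} {c : ℝ} (hf : ContinuousOn f (Icc (s - r) (s + r)))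
    (hG : IntervalIntegrable G volume (s - r) (s + r))
    (h : ∀ x ∈ Icc (s - r) (s + r), f x =
      ∑ i ∈ Finset.range m, d i * (s + r - x) ^ (α + i) +
        c * ∫ y in (s - r)..(s + r), G y * (max (y - x) 0) ^ β) :
    SingularRep m α β (fun t => f (r * t + s)) (fun i => d i * r ^ (α + i))
      (fun τ => c * r ^ (β + 1) * G (r * τ + s)) where
  cont := hf.comp (by fun_prop) fun _ ht => affine_mem_Icc hr ht
  int := (intervalIntegrable_comp_affine hr s hG).const_mul _
  eq t ht := by
    rw [h _ (affine_mem_Icc hr ht), integral_eq_mul_integral_comp_affine hr]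
    congr 1
    · refine Finset.sum_congr rfl fun i _ => ?_
      rw [show s + r - (r * t + s) = r * (1 - t) by ring,
        Real.mul_rpow hr.le (by linarith [ht.2])]
      ring
    · rw [← mul_assoc, ← intervalIntegral.integral_const_mul]
      congr 1
      ext τ
      rw [show r * τ + s - (r * t + s) = r * (τ - t) by ring,
        show max (r * (τ - t)) 0 = r * max (τ - t) 0 by
          rw [mul_max_of_nonneg _ _ hr.le, mul_zero],
        Real.mul_rpow hr.le (le_max_right _ _), Real.rpow_add_one hr.ne']
      ring

lemma singularMass_comp_affine_le {m : ℕ} {α β r : ℝ} (hr : 0 < r) (hr1 : r ≤ 1) (hαβ : α ≤ β)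
    (s : ℝ) (G : ℝ → ℝ) (e L : ℕ → ℝ) (c : ℝ) :
    singularMass m (fun i => e i * L i * r ^ (α + i))
        (fun τ => c * r ^ (β + 1) * G (r * τ + s)) ≤
      (∑ i ∈ Finset.range m, |e i| + |c|) * r ^ α *
        ((∫ y in (s - r)..(s + r), |G y|) + ∑ i ∈ Finset.range m, |L i|) := by
  have hI : 0 ≤ ∫ y in (s - r)..(s + r), |G y| :=
    intervalIntegral.integral_nonneg (by linarith) fun _ _ => abs_nonneg _
  have hrα : 0 ≤ r ^ α := by positivity
  have hE : 0 ≤ ∑ i ∈ Finset.range m, |e i| := Finset.sum_nonneg fun _ _ => abs_nonneg _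
  have hL : 0 ≤ ∑ i ∈ Finset.range m, |L i| := Finset.sum_nonneg fun _ _ => abs_nonneg _
  have h1 : ∑ i ∈ Finset.range m, |e i * L i * r ^ (α + i)| ≤
      (∑ i ∈ Finset.range m, |e i|) * r ^ α * ∑ i ∈ Finset.range m, |L i| := by
    rw [mul_assoc, Finset.sum_mul]
    refine Finset.sum_le_sum fun i hi => ?_
    rw [abs_mul, abs_mul, mul_assoc, abs_of_nonneg (by positivity : 0 ≤ r ^ (α + i)),
      mul_comm |L i|]
    refine mul_le_mul_of_nonneg_left (mul_le_mul ?_ ?_ (abs_nonneg _) hrα) (abs_nonneg _)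
    · exact Real.rpow_le_rpow_of_exponent_ge hr hr1 (by simp)
    · exact Finset.single_le_sum (f := fun i => |L i|) (fun _ _ => abs_nonneg _) hi
  have h2 : ∫ τ in (-1 : ℝ)..1, |c * r ^ (β + 1) * G (r * τ + s)| ≤
      |c| * r ^ α * ∫ y in (s - r)..(s + r), |G y| := by
    have e1 : ∀ τ, |c * r ^ (β + 1) * G (r * τ + s)| =
        |c| * r ^ β * r * |G (r * τ + s)| := fun τ => by
      rw [abs_mul, abs_mul, abs_of_nonneg (by positivity : 0 ≤ r ^ (β + 1)),
        Real.rpow_add_one hr.ne']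
      ring
    simp only [e1]
    rw [intervalIntegral.integral_const_mul, mul_assoc,
      ← integral_eq_mul_integral_comp_affine hr s fun y => |G y|]
    exact mul_le_mul_of_nonneg_right (mul_le_mul_of_nonneg_left
      (Real.rpow_le_rpow_of_exponent_ge hr hr1 hαβ) (abs_nonneg _)) hI
  refine (add_le_add h1 h2).trans ?_
  have h3 : 0 ≤ (∑ i ∈ Finset.range m, |e i|) * r ^ α * ∫ y in (s - r)..(s + r), |G y| := by
    positivity
  have h4 : 0 ≤ |c| * r ^ α * ∑ i ∈ Finset.range m, |L i| := by positivity
  linarith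

/-- scaled estimates for the Gauss–Radau projections `π_p^±` on
`I = (a, x₁)` for `ω̃ ∈ 𝒰^{α,m}_{x₁−}(I)` (right-endpoint singularity, fitted case). -/
theorem stmt_15 (k m : ℕ) (hk : 1 ≤ k) (hm : 1 ≤ m) (α : ℝ)
    (hα1 : (k : ℝ) - 1 < α) (hα2 : α < (k : ℝ)) (hαint : ∀ j : ℤ, α ≠ (j : ℝ))
    (hα0 : 0 < α) (hαm : 1 / 2 < α + (m : ℝ)) :
    ∃ C > (0 : ℝ), ∀ a x₁ : ℝ, a < x₁ → x₁ - a ≤ 2 →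
      ∀ p : ℕ, α + (m : ℝ) < (p : ℝ) + 1 →
        ∀ (ω : ℝ → ℝ) (L : ℕ → ℝ), MemUROn k m α a x₁ ω L →
          (∀ P : Polynomial ℝ, P.natDegree ≤ p →
            (∀ v : Polynomial ℝ, v.natDegree < p →
                ∫ x in a..x₁, (P.eval x - ω x) * v.eval x = 0) →
            P.eval x₁ = ω x₁ →
            Real.sqrt (∫ x in a..x₁, (P.eval x - ω x) ^ 2) ≤
              C * (x₁ - a) ^ (α + 1 / 2) *
                (p : ℝ) ^ (-(min (2 * α + 1 / 2) (α + (m : ℝ) - 1 / 2))) *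
                UsemiROn k m α a x₁ ω L ∧
            |P.eval a - ω a| ≤
              C * (x₁ - a) ^ α *
                (p : ℝ) ^ (-(min (2 * α) (α + (m : ℝ) - 1 / 2))) *
                UsemiROn k m α a x₁ ω L) ∧
          (∀ P : Polynomial ℝ, P.natDegree ≤ p →
            (∀ v : Polynomial ℝ, v.natDegree < p →
                ∫ x in a..x₁, (P.eval x - ω x) * v.eval x = 0) →
            P.eval a = ω a →
            Real.sqrt (∫ x in a..x₁, (P.eval x - ω x) ^ 2) ≤
              C * (x₁ - a) ^ (α + 1 / 2) *
                (p : ℝ) ^ (-(min (2 * α + 1) (α + (m : ℝ) - 1 / 2))) *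
                UsemiROn k m α a x₁ ω L ∧
            |P.eval x₁ - ω x₁| ≤
              C * (x₁ - a) ^ α *
                (p : ℝ) ^ (-(min (2 * α) (α + (m : ℝ) - 1 / 2))) *
                UsemiROn k m α a x₁ ω L) := by
  set β := α + (m : ℝ) - 1 with hβdef
  have hm' : (1 : ℝ) ≤ m := by exact_mod_cast hm
  have hαβ : α ≤ β := by linarith
  have hβ0 : 0 < β := hα0.trans_le hαβ
  have hβe : α + (m : ℝ) - 1 / 2 = β + 1 / 2 := by rw [hβdef]; ring
  obtain ⟨e, c, hrep⟩ := exists_caputoR_representation hk hm hα0 hα2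
  obtain ⟨C, hC, hbound⟩ := exists_radau_bounds m hα0 hαβ
  have hE : 0 ≤ ∑ i ∈ Finset.range m, |e i| := Finset.sum_nonneg fun _ _ => abs_nonneg _
  refine ⟨C * (∑ i ∈ Finset.range m, |e i| + |c| + 1), by positivity, ?_⟩
  intro a x₁ hax hh p hp ω L hω
  have hkp : k ≤ p := by
    have : (k : ℝ) < p + 1 := by linarith
    exact Nat.lt_succ_iff.mp (by exact_mod_cast this)
  obtain ⟨q, hq, hqω⟩ := hrep a x₁ ω L hax hω
  have hrep' := representation_on_Icc (d := fun i => e i * L i) hα0 hβ0 hax hω.1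
    (hω.2.2.2.2.1 m le_rfl) hqω
  obtain ⟨r, s, rfl, rfl⟩ : ∃ r s : ℝ, a = s - r ∧ x₁ = s + r :=
    ⟨(x₁ - a) / 2, (a + x₁) / 2, by ring, by ring⟩
  have hr : 0 < r := by linarith
  have hr1 : r ≤ 1 := by linarith
  have hsing := singularRep_comp_affine (m := m) (f := fun x => ω x - q.eval x) hr
    (hω.1.sub q.continuous.continuousOn) (hω.2.2.2.2.1 m le_rfl) fun x hx => by
      rw [hrep' x hx, add_sub_cancel_left]
  have hmass := singularMass_comp_affine_le (m := m) hr hr1 hαβ s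
    (iteratedDeriv m (caputoR k α (s + r) ω)) e L c
  have hU : 0 ≤ UsemiROn k m α (s - r) (s + r) ω L :=
    add_nonneg (intervalIntegral.integral_nonneg hax.le fun _ _ => abs_nonneg _)
      (Finset.sum_nonneg fun _ _ => abs_nonneg _)
  have hscale : ∀ {z w y : ℝ}, 0 ≤ w → 0 ≤ y → z ≤ C * w *
      singularMass m (fun i => e i * L i * r ^ (α + i)) (fun τ => c * r ^ (β + 1) *
        iteratedDeriv m (caputoR k α (s + r) ω) (r * τ + s)) →
      r ^ y * z ≤ C * (∑ i ∈ Finset.range m, |e i| + |c| + 1) * (s + r - (s - r)) ^ (α + y) *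
        w * UsemiROn k m α (s - r) (s + r) ω L := by
    intro z w y hw hy hz
    have h1 : r ^ (α + y) ≤ (s + r - (s - r)) ^ (α + y) :=
      Real.rpow_le_rpow hr.le (by linarith) (by linarith)
    calc r ^ y * z ≤ r ^ y * (C * w * ((∑ i ∈ Finset.range m, |e i| + |c|) * r ^ α *
          UsemiROn k m α (s - r) (s + r) ω L)) := by
          refine mul_le_mul_of_nonneg_left (hz.trans ?_) (by positivity)
          exact mul_le_mul_of_nonneg_left hmass (by positivity)
      _ = C * (∑ i ∈ Finset.range m, |e i| + |c|) * r ^ (α + y) * w *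
          UsemiROn k m α (s - r) (s + r) ω L := by
          rw [Real.rpow_add hr]
          ring
      _ ≤ _ := by
          gcongr C * ?_ * ?_ * w * _
          linarith
  have hcore : ∀ P : Polynomial ℝ, P.natDegree ≤ p →
      (∀ v : Polynomial ℝ, v.natDegree < p →
        ∫ x in (s - r)..(s + r), (P.eval x - ω x) * v.eval x = 0) →
      _ := fun P hP horth => hbound p (hk.trans hkp) (by linarith) _ _ _ hsing
        ((P - q).comp (Polynomial.C r * Polynomial.X + Polynomial.C s))
        (by
          have h1 : (P - q).natDegree ≤ p :=
            (Polynomial.natDegree_sub_le _ _).trans (max_le hP (hq.le.trans hkp))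
          have h2 : (Polynomial.C r * Polynomial.X + Polynomial.C s : Polynomial ℝ).natDegree
              ≤ 1 := Polynomial.natDegree_linear_le
          refine Polynomial.natDegree_comp_le.trans ?_
          nlinarith)
        fun n hn => by
          have h0 := horth ((legendreP n).comp
            (Polynomial.C r⁻¹ * Polynomial.X + Polynomial.C (-s / r))) (by
              have h1 := (legendreP_degree n).1
              have h2 : (Polynomial.C r⁻¹ * Polynomial.X + Polynomial.C (-s / r) :
                Polynomial ℝ).natDegree ≤ 1 := Polynomial.natDegree_linear_le
              refine Polynomial.natDegree_comp_le.trans_lt ?_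
              nlinarith)
          rw [integral_eq_mul_integral_comp_affine hr] at h0
          rw [← (mul_eq_zero.mp h0).resolve_left hr.ne']
          congr 1
          ext τ
          have h3 : r⁻¹ * (r * τ + s) + -s / r = τ := by
            field_simp
            ring
          simp only [Polynomial.eval_comp, Polynomial.eval_add, Polynomial.eval_mul,
            Polynomial.eval_C, Polynomial.eval_X, Polynomial.eval_sub, h3]
          ring
  have hev : ∀ (P : Polynomial ℝ) (t : ℝ),
      ((P - q).comp (Polynomial.C r * Polynomial.X + Polynomial.C s)).eval t -
        (ω (r * t + s) - q.eval (r * t + s)) = P.eval (r * t + s) - ω (r * t + s) := by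
    intro P t
    simp only [Polynomial.eval_comp, Polynomial.eval_add, Polynomial.eval_mul,
      Polynomial.eval_C, Polynomial.eval_X, Polynomial.eval_sub]
    ring
  have hL2 : ∀ P : Polynomial ℝ, √(∫ x in (s - r)..(s + r), (P.eval x - ω x) ^ 2) =
      r ^ (1 / 2 : ℝ) * √(∫ t in (-1 : ℝ)..1, (P.eval (r * t + s) - ω (r * t + s)) ^ 2) := by
    intro P
    rw [integral_eq_mul_integral_comp_affine hr, Real.sqrt_mul hr.le, ← Real.sqrt_eq_rpow]
  have hl : r * (-1) + s = s - r := by ring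
  have hrt : r * 1 + s = s + r := by ring
  have hw : ∀ y : ℝ, 0 ≤ (p : ℝ) ^ y := fun y => by positivity
  rw [hβe]
  refine ⟨fun P hP horth hend => ?_, fun P hP horth hend => ?_⟩
  · obtain ⟨h1, h2⟩ := (hcore P hP horth).1 (by
      rw [← sub_eq_zero, hev, hrt, hend, sub_self])
    simp only [hev] at h1 h2
    rw [hl] at h2
    exact ⟨hL2 P ▸ hscale (hw _) (by norm_num) h1, by
      simpa using hscale (hw _) le_rfl h2⟩
  · obtain ⟨h1, h2⟩ := (hcore P hP horth).2 (by
      rw [← sub_eq_zero, hev, hl, hend, sub_self])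
    simp only [hev] at h1 h2
    rw [hrt] at h2
    exact ⟨hL2 P ▸ hscale (hw _) (by norm_num) h1, by
      simpa using hscale (hw _) le_rfl h2⟩
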